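/- If the KS distance with threshold d_th = (d_{H,ks}+d_{L,ks})/2 is used in Algorithm 4 (merge-based clustering with unknown number of clusters), the error probability after T iterations satisfies P_e^{KS} ≤ M²·(10T+14)·exp(−nΔ_ks²/8); if MMD² with a kernel bounded by 𝕂 and threshold d_th = (d_{H,mmd}+d_{L,mmd})/2 is used, then P_e^{MMD} ≤ M²·(2T+3)·exp(−nΔ_mmd²/(256𝕂²)), where Δ = d_H − d_L in each case and d_L < d_H is assumed. -/

import Mathlib

open MeasureTheory
open scoped Classical

noncomputable section KMedoids

variable {ι S : Type*} [Fintype ι] [DecidableEq ι]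

/-- An element of the finite set `s` minimizing `f` (with default `d` if `s` is empty). -/
def argminD (s : Finset ι) (f : ι → ℝ) (d : ι) : ι :=
  if h : s.Nonempty then (s.exists_min_image f h).choose else d

/-- An element of the finite set `s` maximizing `f` (with default `d` if `s` is empty). -/
def argmaxD (s : Finset ι) (f : ι → ℝ) (d : ι) : ι :=
  if h : s.Nonempty then (s.exists_max_image f h).choose else d

/-- The cluster (fiber) of the assignment `A : ι → ι` with center `c`. -/
def fiber (A : ι → ι) (c : ι) : Finset ι := Finset.univ.filter fun i => A i = c

/-- Sum of distances from the data sequence indexed `i` to all sequences indexed in `t`. -/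
def sumDist (y : ι → S) (dist : S → S → ℝ) (t : Finset ι) (i : ι) : ℝ :=
  ∑ j ∈ t, dist (y i) (y j)

/-- Center-update step: each point gets re-pointed to the medoid of its current cluster,
i.e. a member of the cluster minimizing the sum of distances to the cluster. -/
def centerUpdate (y : ι → S) (dist : S → S → ℝ) (A : ι → ι) : ι → ι :=
  fun i => argminD (fiber A (A i)) (sumDist y dist (fiber A (A i))) (A i)

/-- Cluster-update step: re-assign each point to a nearest center in `C`, keeping its
current center whenever no strictly closer center exists. -/
def assignNearest (y : ι → S) (dist : S → S → ℝ) (C : Finset ι) (A : ι → ι) : ι → ι :=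
  fun i =>
    if A i ∈ C ∧ ∀ c ∈ C, dist (y i) (y (A i)) ≤ dist (y i) (y c) then A i
    else argminD C (fun c => dist (y i) (y c)) (A i)

/-- Minimum distance from point `i` to the set of centers `C`. -/
def minDistTo (y : ι → S) (dist : S → S → ℝ) (C : Finset ι) (i : ι) : ℝ :=
  if h : C.Nonempty then C.inf' h fun c => dist (y i) (y c) else 0

/-- Farthest-point insertion: add as a new center a sequence with the largest minimum
distance to the existing centers `C`. -/
def fpInsert (y : ι → S) (dist : S → S → ℝ) (C : Finset ι) (d : ι) : Finset ι :=
  insert (argmaxD Finset.univ (minDistTo y dist C) d) C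

/-- `k+1` centers obtained by farthest-point traversal started at the arbitrary center
`i₀` (Algorithm 1, center initialization). -/
def fpCenters (y : ι → S) (dist : S → S → ℝ) (i₀ : ι) : ℕ → Finset ι
  | 0 => {i₀}
  | k + 1 => fpInsert y dist (fpCenters y dist i₀ k) i₀

/-- Initial cluster assignment: each sequence joins a nearest center in `C`. -/
def initAssign (y : ι → S) (dist : S → S → ℝ) (C : Finset ι) : ι → ι :=
  fun i => argminD C (fun c => dist (y i) (y c)) i

/-- One iteration of Algorithm 2: center update followed by cluster update. -/
def stepKnown (y : ι → S) (dist : S → S → ℝ) (A : ι → ι) : ι → ι :=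
  assignNearest y dist (Finset.image (centerUpdate y dist A) Finset.univ)
    (centerUpdate y dist A)

/-- Algorithm 2 (k-medoids clustering with known number `K` of clusters): the assignment
of data sequences to centers after `t` iterations, started from the farthest-point
initialization with first center `i₀`. -/
def alg2 (y : ι → S) (dist : S → S → ℝ) (K : ℕ) (i₀ : ι) : ℕ → (ι → ι)
  | 0 => initAssign y dist (fpCenters y dist i₀ (K - 1))
  | t + 1 => stepKnown y dist (alg2 y dist K i₀ t)

/-- Add a farthest-point center if some sequence is farther than `dth` from all centers. -/
def fpInsertIf (y : ι → S) (dist : S → S → ℝ) (dth : ℝ) (C : Finset ι) (d : ι) : Finset ι :=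
  if ∃ i : ι, dth < minDistTo y dist C i then fpInsert y dist C d else C

/-- Center initialization of Algorithm 3 (merge-based, unknown `K`): keep adding
farthest-point centers until every sequence is within `dth` of some center. -/
def initCentersMerge (y : ι → S) (dist : S → S → ℝ) (dth : ℝ) (i₀ : ι) : Finset ι :=
  (fun C => fpInsertIf y dist dth C i₀)^[Fintype.card ι] {i₀}

/-- Merge two clusters whose centers are within `dth` of each other (if such a pair
exists), keeping the center with the smaller total distance to the other cluster. -/
def mergeOnce (y : ι → S) (dist : S → S → ℝ) (dth : ℝ) (A : ι → ι) : ι → ι :=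
  if h : ∃ pr : ι × ι, pr.1 ∈ Finset.image A Finset.univ ∧
      pr.2 ∈ Finset.image A Finset.univ ∧ pr.1 ≠ pr.2 ∧ dist (y pr.1) (y pr.2) ≤ dth then
    fun i =>
      if A i = h.choose.1 ∨ A i = h.choose.2 then
        if sumDist y dist (fiber A h.choose.1) h.choose.2 <
            sumDist y dist (fiber A h.choose.2) h.choose.1 then h.choose.2
        else h.choose.1
      else A i
  else A

/-- Merge step of Algorithm 4: merge while some two centers are within `dth`. -/
def mergeStep (y : ι → S) (dist : S → S → ℝ) (dth : ℝ) (A : ι → ι) : ι → ι :=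
  (mergeOnce y dist dth)^[Fintype.card ι] A

/-- One iteration of Algorithm 4: center update, merge step, cluster update. -/
def step4 (y : ι → S) (dist : S → S → ℝ) (dth : ℝ) (A : ι → ι) : ι → ι :=
  assignNearest y dist
    (Finset.image (mergeStep y dist dth (centerUpdate y dist A)) Finset.univ)
    (mergeStep y dist dth (centerUpdate y dist A))

/-- Algorithm 4 (merge-based k-medoids clustering with unknown number of clusters and
threshold `dth`): the assignment after `t` iterations, with first initial center `i₀`. -/
def alg4 (y : ι → S) (dist : S → S → ℝ) (dth : ℝ) (i₀ : ι) : ℕ → (ι → ι)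
  | 0 => initAssign y dist (initCentersMerge y dist dth i₀)
  | t + 1 => step4 y dist dth (alg4 y dist dth i₀ t)

/-- One iteration of Algorithm 5: split step (if some sequence is farther than `dth`
from its center, the sequence farthest from its center becomes a new center), followed
by the cluster update. -/
def step5 [Nonempty ι] (y : ι → S) (dist : S → S → ℝ) (dth : ℝ) (A : ι → ι) : ι → ι :=
  if ∃ i : ι, dth < dist (y (A i)) (y i) then
    assignNearest y dist
      (insert (argmaxD Finset.univ (fun i => dist (y (A i)) (y i)) (Classical.arbitrary ι))
        (Finset.image A Finset.univ)) A
  else assignNearest y dist (Finset.image A Finset.univ) A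

/-- Algorithm 5 (split-based k-medoids clustering with unknown number of clusters and
threshold `dth`): the assignment after `t` iterations; initially all sequences form one
cluster whose center is the overall medoid. -/
def alg5 [Nonempty ι] (y : ι → S) (dist : S → S → ℝ) (dth : ℝ) : ℕ → (ι → ι)
  | 0 => fun _ => argminD Finset.univ (sumDist y dist Finset.univ) (Classical.arbitrary ι)
  | t + 1 => step5 y dist dth (alg5 y dist dth t)

/-- A clustering output (an assignment `A` of sequences to centers) is correct iff two
sequences share an output cluster exactly when they were generated from the same
distribution cluster (given by `gen`). -/
def CorrectClustering {κ : Type*} (gen : ι → κ) (A : ι → ι) : Prop :=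
  ∀ i j : ι, A i = A j ↔ gen i = gen j

end KMedoids


/-- Empirical c.d.f. of a sequence of `n` real samples. -/
noncomputable def empCDF {n : ℕ} (x : Fin n → ℝ) (a : ℝ) : ℝ :=
  (Finset.univ.filter fun i => x i ≤ a).card / (n : ℝ)

/-- KS distance between the empirical c.d.f.'s of two sequences. -/
noncomputable def ksDistSeq {n : ℕ} (x y : Fin n → ℝ) : ℝ :=
  ⨆ a : ℝ, |empCDF x a - empCDF y a|

/-- c.d.f. of a measure on ℝ. -/
noncomputable def cdfOf (p : Measure ℝ) (a : ℝ) : ℝ := (p (Set.Iic a)).toReal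

/-- KS distance between two distributions on ℝ. -/
noncomputable def ksDist (p q : Measure ℝ) : ℝ :=
  ⨆ a : ℝ, |cdfOf p a - cdfOf q a|


/-- The unbiased estimator of squared MMD between a sequence `x` of `n` samples and a
sequence `y` of `m` samples, for the kernel `g`:
`(1/(n(n−1))) Σ_{i≠j} g(x i, x j) + (1/(m(m−1))) Σ_{i≠j} g(y i, y j)
  − (2/(nm)) Σ_{i,j} g(x i, y j)`. -/
noncomputable def mmdSqEst {E : Type*} (g : E → E → ℝ) {n m : ℕ}
    (x : Fin n → E) (y : Fin m → E) : ℝ :=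
  (∑ i, ∑ j ∈ Finset.univ.erase i, g (x i) (x j)) / ((n : ℝ) * ((n : ℝ) - 1))
    + (∑ i, ∑ j ∈ Finset.univ.erase i, g (y i) (y j)) / ((m : ℝ) * ((m : ℝ) - 1))
    - 2 * (∑ i, ∑ j, g (x i) (y j)) / ((n : ℝ) * (m : ℝ))

/-- The squared MMD between two distributions, `‖μ_p − μ_q‖²`, expressed through a feature
map `φ` into a Hilbert space (`μ_p = E_p[φ]` is the mean embedding of `p`). -/
noncomputable def mmdSqDist {E : Type*} [MeasurableSpace E] {H : Type*}
    [NormedAddCommGroup H] [InnerProductSpace ℝ H] (φ : E → H) (p q : Measure E) : ℝ :=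
  ‖(∫ z, φ z ∂p) - (∫ z, φ z ∂q)‖ ^ 2

section Deterministic

variable {ι S κ : Type*}

theorem argminD_mem {s : Finset ι} (h : s.Nonempty) (f : ι → ℝ) (d : ι) :
    argminD s f d ∈ s := by
  rw [argminD, dif_pos h]
  exact (s.exists_min_image f h).choose_spec.1

theorem argminD_le {s : Finset ι} (f : ι → ℝ) (d : ι) {j : ι} (hj : j ∈ s) :
    f (argminD s f d) ≤ f j := by
  have h : s.Nonempty := ⟨j, hj⟩
  rw [argminD, dif_pos h]
  exact (s.exists_min_image f h).choose_spec.2 j hj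

theorem le_argmaxD {s : Finset ι} (f : ι → ℝ) (d : ι) {j : ι} (hj : j ∈ s) :
    f j ≤ f (argmaxD s f d) := by
  have h : s.Nonempty := ⟨j, hj⟩
  rw [argmaxD, dif_pos h]
  exact (s.exists_max_image f h).choose_spec.2 j hj

/-- Sequences from a common distribution cluster are within the threshold `dth`, sequences
from different distribution clusters are not. -/
def Separated (gen : ι → κ) (y : ι → S) (dist : S → S → ℝ) (dth : ℝ) : Prop :=
  ∀ i j, dist (y i) (y j) ≤ dth ↔ gen i = gen j

/-- `A` sends every index to a representative of its own class, one for each class. -/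
def IsClassSection (gen : ι → κ) (A : ι → ι) : Prop :=
  (∀ i, gen (A i) = gen i) ∧ ∀ i j, gen i = gen j → A i = A j

theorem IsClassSection.correct {gen : ι → κ} {A : ι → ι} (h : IsClassSection gen A) :
    CorrectClustering gen A := fun i j =>
  ⟨fun e => by rw [← h.1 i, ← h.1 j, e], h.2 i j⟩

variable {gen : ι → κ} {y : ι → S} {dist : S → S → ℝ} {dth : ℝ}

theorem minDistTo_le_iff (hs : Separated gen y dist dth) {C : Finset ι} (hC : C.Nonempty) (i : ι) :
    minDistTo y dist C i ≤ dth ↔ ∃ c ∈ C, gen c = gen i := by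
  rw [minDistTo, dif_pos hC, Finset.inf'_le_iff]
  exact exists_congr fun c => and_congr_right fun _ => (hs i c).trans eq_comm

variable [Fintype ι] [DecidableEq ι]

theorem exists_rep_initCentersMerge (hs : Separated gen y dist dth) (i₀ : ι) :
    Set.InjOn gen (initCentersMerge y dist dth i₀ : Set ι) ∧
      ∀ i, ∃ c ∈ initCentersMerge y dist dth i₀, gen c = gen i := by
  have key : ∀ k : ℕ, let C := (fun C => fpInsertIf y dist dth C i₀)^[k] {i₀}
      C.Nonempty ∧ Set.InjOn gen (C : Set ι) ∧
        ((∀ i, minDistTo y dist C i ≤ dth) ∨ k + 1 ≤ C.card) := by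
    intro k
    induction k with
    | zero => simp
    | succ k ih =>
      simp only [Function.iterate_succ', Function.comp_apply] at ih ⊢
      set C := (fun C => fpInsertIf y dist dth C i₀)^[k] {i₀} with hCdef
      obtain ⟨hne, hinj, hcard⟩ := ih
      unfold fpInsertIf
      by_cases hex : ∃ i : ι, dth < minDistTo y dist C i
      · rw [if_pos hex]
        obtain ⟨i, hi⟩ := hex
        have hmax := hi.trans_le (le_argmaxD (minDistTo y dist C) i₀ (Finset.mem_univ i))
        unfold fpInsert
        set m := argmaxD Finset.univ (minDistTo y dist C) i₀
        have hnot : ∀ c ∈ C, gen c ≠ gen m := fun c hc e =>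
          hmax.not_ge ((minDistTo_le_iff hs hne m).2 ⟨c, hc, e⟩)
        have hm : m ∉ C := fun h => hnot m h rfl
        refine ⟨Finset.insert_nonempty _ _, ?_, Or.inr ?_⟩
        · rw [Finset.coe_insert, Set.injOn_insert (by simpa using hm)]
          refine ⟨hinj, ?_⟩
          rintro ⟨c, hc, e⟩
          exact hnot c hc e
        · rw [Finset.card_insert_of_notMem hm]
          rcases hcard with h | h
          · exact absurd (h i) hi.not_ge
          · omega
      · rw [if_neg hex]
        push Not at hex
        exact ⟨hne, hinj, Or.inl hex⟩
  obtain ⟨hne, hinj, hcard⟩ := key (Fintype.card ι)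
  refine ⟨hinj, fun i => (minDistTo_le_iff hs hne i).1 ?_⟩
  rcases hcard with h | h
  · exact h i
  · have := Finset.card_le_univ
      ((fun C => fpInsertIf y dist dth C i₀)^[Fintype.card ι] {i₀})
    omega

theorem isClassSection_initAssign (hs : Separated gen y dist dth) (i₀ : ι) :
    IsClassSection gen (initAssign y dist (initCentersMerge y dist dth i₀)) := by
  obtain ⟨hinj, hrep⟩ := exists_rep_initCentersMerge hs i₀
  have hmem : ∀ i, initAssign y dist (initCentersMerge y dist dth i₀) i ∈
      initCentersMerge y dist dth i₀ := fun i =>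
    argminD_mem (let ⟨c, hc, _⟩ := hrep i; ⟨c, hc⟩) _ _
  have hgen : ∀ i, gen (initAssign y dist (initCentersMerge y dist dth i₀) i) = gen i := by
    intro i
    obtain ⟨c, hc, e⟩ := hrep i
    exact ((hs i _).1 ((argminD_le (fun c => dist (y i) (y c)) i hc).trans
      ((hs i c).2 e.symm))).symm
  exact ⟨hgen, fun i j e => hinj (hmem i) (hmem j) (by rw [hgen, hgen, e])⟩

theorem IsClassSection.centerUpdate {A : ι → ι} (h : IsClassSection gen A) :
    IsClassSection gen (centerUpdate y dist A) := by
  refine ⟨fun i => ?_, fun i j e => ?_⟩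
  · have hm : _root_.centerUpdate y dist A i ∈ fiber A (A i) :=
      argminD_mem ⟨i, by simp [fiber]⟩ _ _
    simp only [fiber, Finset.mem_filter, Finset.mem_univ, true_and] at hm
    rw [← h.1, hm, h.1]
  · simp only [_root_.centerUpdate, h.2 i j e]

theorem IsClassSection.mergeStep_eq {A : ι → ι} (hs : Separated gen y dist dth)
    (h : IsClassSection gen A) : mergeStep y dist dth A = A := by
  have h1 : mergeOnce y dist dth A = A := by
    rw [mergeOnce, dif_neg]
    rintro ⟨⟨c, c'⟩, hc, hc', hne, hd⟩
    simp only [Finset.mem_image, Finset.mem_univ, true_and] at hc hc'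
    obtain ⟨⟨i, rfl⟩, ⟨j, rfl⟩⟩ := And.intro hc hc'
    have := (hs _ _).1 hd
    rw [h.1, h.1] at this
    exact hne (h.2 i j this)
  exact Function.iterate_fixed h1 _

theorem IsClassSection.assignNearest_eq {A : ι → ι} (hs : Separated gen y dist dth)
    (h : IsClassSection gen A) : assignNearest y dist (Finset.image A Finset.univ) A = A := by
  funext i
  rw [assignNearest]
  split_ifs with hi
  · rfl
  · have hmemi : A i ∈ Finset.image A Finset.univ := Finset.mem_image_of_mem _ (Finset.mem_univ i)
    have hm := argminD_mem ⟨A i, hmemi⟩ (fun c => dist (y i) (y c)) (A i)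
    have hle := argminD_le (fun c => dist (y i) (y c)) (A i) hmemi
    obtain ⟨j, -, hj⟩ := Finset.mem_image.1 hm
    rw [← hj] at hle ⊢
    have hg := (hs i (A j)).1 (hle.trans ((hs i (A i)).2 (h.1 i).symm))
    exact h.2 j i (by rw [hg, h.1])

/-- Algorithm 4 recovers the distribution clusters when the threshold separates them. -/
theorem correctClustering_alg4 (hs : Separated gen y dist dth) (i₀ : ι) (t : ℕ) :
    CorrectClustering gen (alg4 y dist dth i₀ t) := by
  refine IsClassSection.correct ?_
  induction t with
  | zero => exact isClassSection_initAssign hs i₀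
  | succ t ih =>
    have hc := ih.centerUpdate (y := y) (dist := dist)
    rw [alg4, step4, hc.mergeStep_eq hs, hc.assignNearest_eq hs]
    exact hc

end Deterministic

section BinaryDivergence

open Real Set

theorem four_mul_le_log_odds {r e : ℝ} (hr : 0 < r) (he : 0 ≤ e) (hre : r + e < 1) :
    4 * e ≤ log (r + e) - log r - log (1 - r - e) + log (1 - r) := by
  have hd : ∀ x ∈ Icc 0 e, HasDerivAt
      (fun x => log (r + x) - log (1 - r - x) - 4 * x)
      (1 / (r + x) - (-1) / (1 - r - x) - 4 * 1) x := by
    intro x hx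
    have h1 : r + x ≠ 0 := by linarith [hx.1]
    have h2 : 1 - r - x ≠ 0 := by linarith [hx.2]
    exact ((((hasDerivAt_id x).const_add r).log h1).sub
      (((hasDerivAt_id x).const_sub (1 - r)).log h2)).sub ((hasDerivAt_id x).const_mul 4)
  have hmono : MonotoneOn (fun x => log (r + x) - log (1 - r - x) - 4 * x) (Icc 0 e) := by
    refine monotoneOn_of_deriv_nonneg (convex_Icc 0 e)
      (fun x hx => (hd x hx).continuousAt.continuousWithinAt)
      (fun x hx => (hd x (interior_subset hx)).differentiableAt.differentiableWithinAt)
      fun x hx => ?_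
    have hx := interior_subset hx
    rw [(hd x hx).deriv]
    have h1 : 0 < r + x := by linarith [hx.1]
    have h2 : 0 < 1 - r - x := by linarith [hx.2]
    have : 1 / (r + x) - (-1) / (1 - r - x) - 4 * 1 =
        (1 - 2 * (r + x)) ^ 2 / ((r + x) * (1 - r - x)) := by
      field_simp
      ring
    rw [this]
    positivity
  have := hmono (left_mem_Icc.2 he) (right_mem_Icc.2 he) he
  simp only [add_zero, sub_zero, mul_zero] at this
  linarith

/-- Pinsker's inequality for two Bernoulli distributions. -/
theorem two_mul_sq_le_binary_divergence {r e : ℝ} (hr : 0 < r) (he : 0 ≤ e) (hre : r + e < 1) :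
    2 * e ^ 2 ≤ (r + e) * (log (r + e) - log r) +
      (1 - r - e) * (log (1 - r - e) - log (1 - r)) := by
  have hd : ∀ x ∈ Icc 0 e, HasDerivAt
      (fun x => (r + x) * (log (r + x) - log r) +
        (1 - r - x) * (log (1 - r - x) - log (1 - r)) - 2 * x ^ 2)
      ((1 * (log (r + x) - log r) + (r + x) * (1 / (r + x))) +
        ((-1) * (log (1 - r - x) - log (1 - r)) + (1 - r - x) * ((-1) / (1 - r - x)))
          - 2 * (2 * x)) x := by
    intro x hx
    have h1 : r + x ≠ 0 := by linarith [hx.1]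
    have h2 : 1 - r - x ≠ 0 := by linarith [hx.2]
    have e1 := (hasDerivAt_id x).const_add r
    have e2 := (hasDerivAt_id x).const_sub (1 - r)
    have e3 : HasDerivAt (fun x : ℝ => x ^ 2) (2 * x) x := by simpa using hasDerivAt_pow 2 x
    exact ((e1.mul ((e1.log h1).sub_const _)).add (e2.mul ((e2.log h2).sub_const _))).sub
      (e3.const_mul 2)
  have hmono : MonotoneOn (fun x => (r + x) * (log (r + x) - log r) +
        (1 - r - x) * (log (1 - r - x) - log (1 - r)) - 2 * x ^ 2) (Icc 0 e) := by
    refine monotoneOn_of_deriv_nonneg (convex_Icc 0 e)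
      (fun x hx => (hd x hx).continuousAt.continuousWithinAt)
      (fun x hx => (hd x (interior_subset hx)).differentiableAt.differentiableWithinAt)
      fun x hx => ?_
    have hx := interior_subset hx
    rw [(hd x hx).deriv]
    have h1 : r + x ≠ 0 := by linarith [hx.1]
    have h2 : 1 - r - x ≠ 0 := by linarith [hx.2]
    have := four_mul_le_log_odds hr hx.1 (by linarith [hx.2])
    rw [mul_one_div_cancel h1, mul_div_cancel₀ _ h2]
    linarith
  have := hmono (left_mem_Icc.2 he) (right_mem_Icc.2 he) he
  simp only [add_zero, sub_zero, sub_self, mul_zero, ne_eq, OfNat.ofNat_ne_zero, not_false_eq_true,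
    zero_pow] at this
  linarith

theorem antitoneOn_one_add_mul_log_sub_div_sq :
    AntitoneOn (fun y : ℝ => ((1 + y) * log (1 + y) - y) / y ^ 2) (Ioi 0) := by
  have hd : ∀ y ∈ Ioi (0 : ℝ), HasDerivAt (fun y : ℝ => ((1 + y) * log (1 + y) - y) / y ^ 2)
      (((1 * log (1 + y) + (1 + y) * (1 / (1 + y)) - 1) * y ^ 2 -
        ((1 + y) * log (1 + y) - y) * (2 * y)) / (y ^ 2) ^ 2) y := by
    intro y hy
    have hy : 0 < y := hy
    have e1 := (hasDerivAt_id y).const_add 1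
    have e3 : HasDerivAt (fun x : ℝ => x ^ 2) (2 * y) y := by simpa using hasDerivAt_pow 2 y
    exact ((e1.mul (e1.log (by simp; linarith))).sub (hasDerivAt_id y)).div e3 (by positivity)
  refine antitoneOn_of_deriv_nonpos (convex_Ioi 0)
    (fun x hx => (hd x hx).continuousAt.continuousWithinAt)
    (fun x hx => (hd x (interior_subset hx)).differentiableAt.differentiableWithinAt)
    fun y hy => ?_
  have hy := interior_subset hy
  rw [(hd y hy).deriv]
  have hy : 0 < y := hy
  have hl := le_log_one_add_of_nonneg hy.le
  rw [div_le_iff₀ (by linarith)] at hl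
  refine div_nonpos_of_nonpos_of_nonneg ?_ (by positivity)
  rw [mul_one_div_cancel (by linarith)]
  nlinarith

theorem add_mul_log_ge_of_stationary {c ε y₀ y : ℝ} (hc : 0 < c) (hy₀ : 0 < y₀) (hy : 0 < y)
    (hst : ((1 + y₀) * log (1 + y₀) - y₀) / y₀ ^ 2 = ε / c) :
    (c / y₀ + ε) * log (1 + y₀) ≤ (c / y + ε) * log (1 + y) := by
  have hd : ∀ y ∈ Ioi (0 : ℝ), HasDerivAt (fun y : ℝ => (c / y + ε) * log (1 + y))
      (c / (1 + y) * (ε / c - ((1 + y) * log (1 + y) - y) / y ^ 2)) y := by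
    intro y hy
    have hy : 0 < y := hy
    have e1 := (hasDerivAt_id y).const_add 1
    have e2 := ((hasDerivAt_inv hy.ne').const_mul c).add_const ε
    have e3 := e2.mul (e1.log (by simp; linarith))
    simp only [← div_eq_mul_inv] at e3
    refine e3.congr_deriv ?_
    simp only [id]
    field_simp
    ring
  have hcont : ContinuousOn (fun y : ℝ => (c / y + ε) * log (1 + y)) (Ioi 0) :=
    fun x hx => (hd x hx).continuousAt.continuousWithinAt
  rcases le_total y y₀ with h | h
  · have hsub : Icc y y₀ ⊆ Ioi 0 := fun x hx => hy.trans_le hx.1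
    refine antitoneOn_of_deriv_nonpos (convex_Icc y y₀) (hcont.mono hsub)
      (fun x hx => (hd x (hsub (interior_subset hx))).differentiableAt.differentiableWithinAt)
      (fun x hx => ?_) (left_mem_Icc.2 h) (right_mem_Icc.2 h) h
    have hx := interior_subset hx
    rw [(hd x (hsub hx)).deriv, ← hst]
    have := antitoneOn_one_add_mul_log_sub_div_sq (hsub hx) hy₀ hx.2
    have h0 : 0 < x := hsub hx
    exact mul_nonpos_of_nonneg_of_nonpos (by positivity) (sub_nonpos.2 this)
  · have hsub : Icc y₀ y ⊆ Ioi 0 := fun x hx => hy₀.trans_le hx.1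
    refine monotoneOn_of_deriv_nonneg (convex_Icc y₀ y) (hcont.mono hsub)
      (fun x hx => (hd x (hsub (interior_subset hx))).differentiableAt.differentiableWithinAt)
      (fun x hx => ?_) (left_mem_Icc.2 h) (right_mem_Icc.2 h) h
    have hx := interior_subset hx
    rw [(hd x (hsub hx)).deriv, ← hst]
    have := antitoneOn_one_add_mul_log_sub_div_sq hy₀ (hsub hx) hx.1
    have h0 : 0 < x := hsub hx
    exact mul_nonneg (by positivity) (sub_nonneg.2 this)

theorem exists_stationary_divergence {ε : ℝ} (hε : 0 < ε) (hε1 : ε < 1) :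
    ∃ r, 0 < r ∧ r + ε < 1 ∧
      log (r + ε) - log r - log (1 - r - ε) + log (1 - r) = ε / (r * (1 - r)) := by
  set R := 2 / (1 - ε) with hR
  set δ := ε * (1 - ε) * exp (-R) / 4 with hδ
  have h1ε : 0 < 1 - ε := by linarith
  have hRpos : 0 < R := by positivity
  have hδpos : 0 < δ := by positivity
  have hexp : exp (-R) < 1 := by simpa using hRpos
  have hδle : δ < (1 - ε) / 2 := by
    rw [hδ]
    have : ε * (1 - ε) * exp (-R) ≤ 1 * (1 - ε) * 1 := by gcongr
    linarith
  let k : ℝ → ℝ := fun r => log (r + ε) - log r - log (1 - r - ε) + log (1 - r) - ε / (r * (1 - r))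
  have hcont : ContinuousOn k (Icc ((1 - ε) / 2) (1 - ε - δ)) := by
    intro r hr
    have h1 : 0 < r := by linarith [hr.1]
    have h2 : 0 < 1 - r - ε := by linarith [hr.2]
    have h3 : 0 < 1 - r := by linarith
    have h4 : r + ε ≠ 0 := by linarith
    have h5 : r * (1 - r) ≠ 0 := by positivity
    apply ContinuousAt.continuousWithinAt
    have := h1.ne'
    have := h2.ne'
    have := h3.ne'
    fun_prop (disch := assumption)
  have hleft : k ((1 - ε) / 2) ≤ 0 := by
    have hx : 1 ≤ (1 + ε) / (1 - ε) := by rw [le_div_iff₀ h1ε]; linarith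
    have hs := self_le_sinh_iff.2 (log_nonneg hx)
    rw [sinh_log (by positivity), log_div (by linarith) h1ε.ne'] at hs
    have e1 : (1 - ε) / 2 + ε = (1 + ε) / 2 := by ring
    have e2 : (1 + ε) / 2 - ε = (1 - ε) / 2 := by ring
    have e3 : 1 - (1 - ε) / 2 = (1 + ε) / 2 := by ring
    have e4 : ε / ((1 - ε) / 2 * ((1 + ε) / 2)) =
        2 * (((1 + ε) / (1 - ε) - ((1 + ε) / (1 - ε))⁻¹) / 2) := by
      field_simp
      ring
    simp only [k, e1, e3, e4, e2]
    rw [log_div (by linarith) two_ne_zero, log_div h1ε.ne' two_ne_zero]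
    linarith
  have hright : 0 ≤ k (1 - ε - δ) := by
    have e1 : 1 - ε - δ + ε = 1 - δ := by ring
    have e2 : ε + δ - ε = δ := by ring
    have e3 : 1 - (1 - ε - δ) = ε + δ := by ring
    have hr0 : 0 < 1 - ε - δ := by linarith
    simp only [k, e1, e3, e2]
    have hb : ε / ((1 - ε - δ) * (ε + δ)) ≤ R := by
      rw [div_le_iff₀ (by positivity), hR]
      have : (1 - ε) / 2 * ε ≤ (1 - ε - δ) * (ε + δ) := by
        apply mul_le_mul <;> linarith
      calc ε = 2 / (1 - ε) * ((1 - ε) / 2 * ε) := by field_simp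
        _ ≤ _ := by gcongr
    have l1 : log δ = log ε + log (1 - ε) - R - log 4 := by
      rw [hδ, log_div (by positivity) (by norm_num), log_mul (by positivity) (exp_ne_zero _),
        log_mul hε.ne' h1ε.ne', log_exp]
      ring
    have l2 : log ε ≤ log (ε + δ) := log_le_log hε (by linarith)
    have l3 : log (1 / 2) ≤ log (1 - δ) := log_le_log (by norm_num) (by linarith)
    have l4 : log (1 - ε - δ) ≤ 0 := log_nonpos hr0.le (by linarith)
    have l5 : log (1 - ε) ≤ 0 := log_nonpos h1ε.le (by linarith)
    have l6 : log (4 : ℝ) = 2 * log 2 := by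
      rw [show (4 : ℝ) = 2 ^ 2 by norm_num, log_pow]; norm_num
    have l7 : log (1 / 2 : ℝ) = - log 2 := by rw [one_div, log_inv]
    have l8 : 0 < log 2 := log_pos (by norm_num)
    linarith
  obtain ⟨r, hr, hkr⟩ := intermediate_value_Icc (by linarith) hcont ⟨hleft, hright⟩
  exact ⟨r, by linarith [hr.1], by linarith [hr.2], by simp only [k] at hkr; linarith⟩

/-- A tilting parameter that serves all crossing levels `r` simultaneously. -/
theorem exists_uniform_tilt {ε : ℝ} (hε : 0 < ε) (hε1 : ε < 1) :
    ∃ c, 0 < c ∧ ∀ r, 0 < r → log (1 + c) + 2 * ε ^ 2 ≤ (r + ε) * log (1 + c / r) := by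
  obtain ⟨r₀, hr₀, hrε, hst⟩ := exists_stationary_divergence hε hε1
  have h1 : 0 < 1 - r₀ - ε := by linarith
  have h2 : 0 < 1 - r₀ := by linarith
  have h3 : 0 < r₀ + ε := by linarith
  set c := ε / (1 - r₀ - ε) with hc
  have hcpos : 0 < c := by positivity
  have hlogc : log (1 + c) = log (1 - r₀) - log (1 - r₀ - ε) := by
    rw [← log_div h2.ne' h1.ne', hc]
    congr 1
    field_simp
    ring
  have hlogy : log (1 + c / r₀) = ε / (r₀ * (1 - r₀)) := by
    rw [← hst]
    have : 1 + c / r₀ = (r₀ + ε) * (1 - r₀) / (r₀ * (1 - r₀ - ε)) := by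
      rw [hc]
      field_simp
      ring
    rw [this, log_div (by positivity) (by positivity), log_mul h3.ne' h2.ne',
      log_mul hr₀.ne' h1.ne']
    ring
  refine ⟨c, hcpos, fun r hr => ?_⟩
  have key := add_mul_log_ge_of_stationary (c := c) (ε := ε) (y₀ := c / r₀) (y := c / r) hcpos
    (by positivity) (by positivity) (by
      rw [hlogy, hc]
      field_simp
      ring)
  rw [div_div_cancel₀ hcpos.ne', div_div_cancel₀ hcpos.ne'] at key
  refine le_trans ?_ key
  have hp := two_mul_sq_le_binary_divergence hr₀ hε.le hrε
  rw [hlogy, ← hst, hlogc]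
  linarith

end BinaryDivergence

section DKW

open scoped ENNReal

variable {E : Type*} [MeasurableSpace E]

theorem pi_withDensity {n : ℕ} (p : Measure E) [IsProbabilityMeasure p] {f : E → ℝ≥0∞}
    (hf : Measurable f) [IsFiniteMeasure (p.withDensity f)] :
    (Measure.pi fun _ : Fin n => p.withDensity f) =
      (Measure.pi fun _ : Fin n => p).withDensity fun x => ∏ i, f (x i) := by
  refine Measure.pi_eq fun s hs => ?_
  rw [withDensity_apply _ (MeasurableSet.univ_pi hs), ← lintegral_indicator (MeasurableSet.univ_pi hs)]
  have h1 : ∀ x : Fin n → E, (Set.univ.pi s).indicator (fun x => ∏ i, f (x i)) x =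
      ∏ i, (s i).indicator f (x i) := by
    intro x
    by_cases hx : x ∈ Set.univ.pi s
    · rw [Set.indicator_of_mem hx]
      exact Finset.prod_congr rfl fun i _ => (Set.indicator_of_mem (hx i trivial) f).symm
    · rw [Set.indicator_of_notMem hx]
      simp only [Set.mem_pi, Set.mem_univ, forall_const, not_forall] at hx
      obtain ⟨i, hi⟩ := hx
      exact (Finset.prod_eq_zero (Finset.mem_univ i) (Set.indicator_of_notMem hi f)).symm
  simp only [h1]
  have hm : ∀ i, Measurable ((s i).indicator f) := fun i => hf.indicator (hs i)
  rw [ProbabilityTheory.lintegral_prod_eq_prod_lintegral_of_indepFun Finset.univ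
    (fun i (x : Fin n → E) => (s i).indicator f (x i))
    (ProbabilityTheory.iIndepFun_pi (μ := fun _ : Fin n => p) fun i => (hm i).aemeasurable)
    (fun i => (hm i).comp (measurable_pi_apply i))]
  refine Finset.prod_congr rfl fun i _ => ?_
  refine ((measurePreserving_eval (fun _ : Fin n => p) i).lintegral_comp (hm i)).trans ?_
  rw [lintegral_indicator (hs i), withDensity_apply _ (hs i)]

/-- The density `1 + C / p B` on `B`, and `1` off `B`. -/
noncomputable def tiltDensity (p : Measure E) (C : ℝ≥0∞) (B : Set E) (x : E) : ℝ≥0∞ :=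
  1 + B.indicator (fun _ => C / p B) x

theorem measurable_tiltDensity (p : Measure E) (C : ℝ≥0∞) {B : Set E} (hB : MeasurableSet B) :
    Measurable (tiltDensity p C B) :=
  (measurable_const.indicator hB).const_add 1

/-- The measure `p + C • p(· | B)`. -/
noncomputable def tilt (p : Measure E) (C : ℝ≥0∞) (B : Set E) : Measure E :=
  p.withDensity (tiltDensity p C B)

theorem tilt_apply (p : Measure E) (C : ℝ≥0∞) {A B : Set E} (hA : MeasurableSet A)
    (hB : MeasurableSet B) : tilt p C B A = p A + C / p B * p (B ∩ A) := by
  rw [tilt, withDensity_apply _ hA]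
  simp only [tiltDensity]
  rw [lintegral_add_left measurable_const, lintegral_indicator_const hB, setLIntegral_one,
    Measure.restrict_apply hB]

theorem tilt_apply_of_subset (p : Measure E) [IsFiniteMeasure p] (C : ℝ≥0∞) {A B : Set E}
    (hA : MeasurableSet A) (hB : MeasurableSet B) (h : B ⊆ A) (hpB : p B ≠ 0) :
    tilt p C B A = p A + C := by
  rw [tilt_apply p C hA hB, Set.inter_eq_left.2 h, ENNReal.div_mul_cancel hpB (measure_ne_top p B)]

theorem isFiniteMeasure_tilt (p : Measure E) [IsFiniteMeasure p] {C : ℝ≥0∞} (hC : C ≠ ∞)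
    {B : Set E} (hB : MeasurableSet B) (hpB : p B ≠ 0) : IsFiniteMeasure (tilt p C B) := by
  refine ⟨?_⟩
  rw [tilt_apply_of_subset p C MeasurableSet.univ hB (Set.subset_univ _) hpB]
  exact ENNReal.add_lt_top.2 ⟨measure_lt_top _ _, hC.lt_top⟩

theorem map_collapse_tilt (p : Measure E) [IsFiniteMeasure p] (C : ℝ≥0∞) {B B' : Set E}
    (hB : MeasurableSet B) (hB' : MeasurableSet B') (h : B' ⊆ B) (hpB' : p B' ≠ 0) {b : E} :
    (tilt p C B).map (fun x => if x ∈ B then b else x) =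
      (tilt p C B').map (fun x => if x ∈ B then b else x) := by
  have hm : Measurable (fun x => if x ∈ B then b else x) :=
    Measurable.ite hB measurable_const measurable_id
  have hpB : p B ≠ 0 := fun h0 => hpB' (measure_mono_null h h0)
  ext A hA
  rw [Measure.map_apply hm hA, Measure.map_apply hm hA]
  have hA' := hm hA
  by_cases hbA : b ∈ A
  · have hsub : B ⊆ (fun x => if x ∈ B then b else x) ⁻¹' A := fun x hx => by
      simp [hx, hbA]
    rw [tilt_apply_of_subset p C hA' hB hsub hpB,
      tilt_apply_of_subset p C hA' hB' (h.trans hsub) hpB']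
  · have hdis : B ∩ (fun x => if x ∈ B then b else x) ⁻¹' A = ∅ := by
      ext x
      simp only [Set.mem_inter_iff, Set.mem_preimage, Set.mem_empty_iff_false, iff_false, not_and]
      intro hx
      simpa [hx] using hbA
    have hdis' : B' ∩ (fun x => if x ∈ B then b else x) ⁻¹' A = ∅ :=
      Set.subset_eq_empty (Set.inter_subset_inter_left _ h) hdis
    rw [tilt_apply p C hA' hB, tilt_apply p C hA' hB', hdis, hdis']
    simp

theorem pi_tilt_eq_of_invariant {n : ℕ} (p : Measure E) [IsFiniteMeasure p] {C : ℝ≥0∞}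
    (hC : C ≠ ∞) {B B' : Set E} (hB : MeasurableSet B) (hB' : MeasurableSet B') (h : B' ⊆ B)
    (hpB' : p B' ≠ 0) {b : E} {S : Set (Fin n → E)} (hS : MeasurableSet S)
    (hinv : (fun (x : Fin n → E) i => if x i ∈ B then b else x i) ⁻¹' S = S) :
    (Measure.pi fun _ : Fin n => tilt p C B) S = (Measure.pi fun _ : Fin n => tilt p C B') S := by
  have hpB : p B ≠ 0 := fun h0 => hpB' (measure_mono_null h h0)
  have := isFiniteMeasure_tilt p hC hB hpB
  have := isFiniteMeasure_tilt p hC hB' hpB'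
  have hm : Measurable (fun x => if x ∈ B then b else x) :=
    Measurable.ite hB measurable_const measurable_id
  have hm' : Measurable (fun (x : Fin n → E) i => if x i ∈ B then b else x i) :=
    measurable_pi_lambda _ fun i => hm.comp (measurable_pi_apply i)
  have e := fun (q : Measure E) [IsFiniteMeasure q] =>
    Measure.pi_map_pi (ι := Fin n) (μ := fun _ => q) (f := fun _ x => if x ∈ B then b else x)
      fun _ => hm.aemeasurable
  conv_lhs => rw [← hinv]
  conv_rhs => rw [← hinv]
  rw [← Measure.map_apply hm' hS, ← Measure.map_apply hm' hS, e, e,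
    map_collapse_tilt p C hB hB' h hpB']

theorem prod_tiltDensity {n : ℕ} (p : Measure E) (C : ℝ≥0∞) (B : Set E) (x : Fin n → E) :
    ∏ i, tiltDensity p C B (x i) =
      (1 + C / p B) ^ (Finset.univ.filter fun i => x i ∈ B).card := by
  have : ∀ i, tiltDensity p C B (x i) = if x i ∈ B then 1 + C / p B else 1 := by
    intro i
    by_cases h : x i ∈ B <;> simp [tiltDensity, h]
  simp only [this, Finset.prod_ite, Finset.prod_const, one_pow, mul_one]

theorem measurableSet_le_card {n : ℕ} {B : Set E} (hB : MeasurableSet B) (r : ℝ) :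
    MeasurableSet {x : Fin n → E | r ≤ ((Finset.univ.filter fun i => x i ∈ B).card : ℝ)} := by
  have : ∀ x : Fin n → E, ((Finset.univ.filter fun i => x i ∈ B).card : ℝ) =
      ∑ i, B.indicator (fun _ => (1 : ℝ)) (x i) := by
    intro x
    simp [Set.indicator_apply]
  simp only [this]
  refine measurableSet_le measurable_const (Finset.measurable_sum _ fun i _ => ?_)
  exact (measurable_const.indicator hB).comp (measurable_pi_apply i)

/-- The one-sided Dvoretzky–Kiefer–Wolfowitz inequality over a finite chain of sets. -/
theorem measure_exists_mem_chain_le {α : Type*} [LinearOrder α] (p : Measure E)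
    [IsProbabilityMeasure p] {B : α → Set E} (hB : ∀ a, MeasurableSet (B a)) (hmono : Monotone B)
    {n : ℕ} {ε : ℝ} (hε : 0 < ε) (s : Finset α) (hpos : ∀ a ∈ s, p (B a) ≠ 0) :
    (Measure.pi fun _ : Fin n => p) {x | ∃ a ∈ s, (n : ℝ) * (p.real (B a) + ε) ≤
        ((Finset.univ.filter fun i => x i ∈ B a).card : ℝ)} ≤
      ENNReal.ofReal (Real.exp (-(2 * n * ε ^ 2))) := by
  rcases Nat.eq_zero_or_pos n with rfl | hn
  · simpa using prob_le_one
  have hn' : (0 : ℝ) < n := by exact_mod_cast hn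
  have hrpos : ∀ a ∈ s, 0 < p.real (B a) := fun a ha =>
    ENNReal.toReal_pos (hpos a ha) (measure_ne_top _ _)
  rcases le_or_gt 1 ε with hε1 | hε1
  · refine (measure_mono_null ?_ measure_empty).trans_le zero_le
    rintro x ⟨a, ha, hx⟩
    have h1 : ((Finset.univ.filter fun i => x i ∈ B a).card : ℝ) ≤ n := by
      exact_mod_cast (Finset.card_le_univ _).trans_eq (Fintype.card_fin n)
    have h2 := hrpos a ha
    nlinarith
  rcases s.eq_empty_or_nonempty with rfl | hs
  · simp
  obtain ⟨c, hc, hcr⟩ := exists_uniform_tilt hε hε1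
  set C := ENNReal.ofReal c with hCdef
  have hCtop : C ≠ ∞ := ENNReal.ofReal_ne_top
  set m := s.min' hs with hm
  have hms : m ∈ s := s.min'_mem hs
  let X : α → Set (Fin n → E) := fun a => {x | (n : ℝ) * (p.real (B a) + ε) ≤
        ((Finset.univ.filter fun i => x i ∈ B a).card : ℝ)}
  let F : α → Set (Fin n → E) := fun a => X a \ ⋃ a' ∈ s.filter (a < ·), X a'
  have hXm : ∀ a, MeasurableSet (X a) := fun a => measurableSet_le_card (hB a) _
  have hFm : ∀ a, MeasurableSet (F a) := fun a =>
    (hXm a).diff (Finset.measurableSet_biUnion _ fun a' _ => hXm a')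
  have hcover : {x | ∃ a ∈ s, (n : ℝ) * (p.real (B a) + ε) ≤
        ((Finset.univ.filter fun i => x i ∈ B a).card : ℝ)} ⊆ ⋃ a ∈ s, F a := by
    rintro x ⟨a, ha, hx⟩
    have hne : (s.filter fun a => x ∈ X a).Nonempty := ⟨a, Finset.mem_filter.2 ⟨ha, hx⟩⟩
    have hmax := Finset.max'_mem _ hne
    refine Set.mem_biUnion (Finset.mem_filter.1 hmax).1 ⟨(Finset.mem_filter.1 hmax).2, ?_⟩
    simp only [Set.mem_iUnion, not_exists]
    intro a' ha' hx'
    obtain ⟨h1, h2⟩ := Finset.mem_filter.1 ha'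
    exact h2.not_ge (Finset.le_max' _ _ (Finset.mem_filter.2 ⟨h1, hx'⟩))
  have hdisj : (s : Set α).PairwiseDisjoint F := by
    intro a ha a' ha' hne
    refine Set.disjoint_left.2 fun x hx hx' => ?_
    rcases lt_or_gt_of_ne hne with h | h
    · exact hx.2 (Set.mem_biUnion (Finset.mem_coe.2 (Finset.mem_filter.2 ⟨ha', h⟩)) hx'.1)
    · exact hx'.2 (Set.mem_biUnion (Finset.mem_coe.2 (Finset.mem_filter.2 ⟨ha, h⟩)) hx.1)
  have hfin : ∀ a ∈ s, IsFiniteMeasure (tilt p C (B a)) := fun a ha =>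
    isFiniteMeasure_tilt p hCtop (hB a) (hpos a ha)
  have := hfin m hms
  set D := (1 + C) ^ n * ENNReal.ofReal (Real.exp (2 * n * ε ^ 2)) with hD
  have hstep : ∀ a ∈ s, D * (Measure.pi fun _ : Fin n => p) (F a) ≤
      (Measure.pi fun _ : Fin n => tilt p C (B m)) (F a) := by
    intro a ha
    have := hfin a ha
    obtain ⟨b, hb⟩ : (B a).Nonempty := Set.nonempty_iff_ne_empty.2 fun h => hpos a ha (by simp [h])
    have hinv : (fun (x : Fin n → E) i => if x i ∈ B a then b else x i) ⁻¹' F a = F a := by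
      have hmem : ∀ a', a ≤ a' → ∀ y, (if y ∈ B a then b else y) ∈ B a' ↔ y ∈ B a' := by
        intro a' haa' y
        split_ifs with hy
        · exact iff_of_true (hmono haa' hb) (hmono haa' hy)
        · rfl
      have hX : ∀ a', a ≤ a' →
          (fun (x : Fin n → E) i => if x i ∈ B a then b else x i) ⁻¹' X a' = X a' := by
        intro a' haa'
        ext x
        simp only [X, Set.mem_preimage, Set.mem_ofPred_eq, hmem a' haa']
      simp only [F, Set.preimage_sdiff, Set.preimage_iUnion, hX a le_rfl]
      congr 1
      refine Set.iUnion_congr fun a' => Set.iUnion_congr fun h => hX a' ?_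
      exact (Finset.mem_filter.1 h).2.le
    rw [← pi_tilt_eq_of_invariant p hCtop (hB a) (hB m) (hmono (s.min'_le a ha)) (hpos m hms)
      (hFm a) hinv]
    have hdens := measurable_tiltDensity p C (hB a)
    have : IsFiniteMeasure (p.withDensity (tiltDensity p C (B a))) := hfin a ha
    rw [tilt, pi_withDensity p hdens, withDensity_apply _ (hFm a), ← setLIntegral_const]
    refine setLIntegral_mono (Finset.measurable_prod _ fun i _ =>
      hdens.comp (measurable_pi_apply i)) fun x hx => ?_
    rw [prod_tiltDensity]
    have hr := hrpos a ha
    have hx : (n : ℝ) * (p.real (B a) + ε) ≤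
        ((Finset.univ.filter fun i => x i ∈ B a).card : ℝ) := hx.1
    set N := (Finset.univ.filter fun i => x i ∈ B a).card
    have hCr : C / p (B a) = ENNReal.ofReal (c / p.real (B a)) := by
      rw [ENNReal.ofReal_div_of_pos hr, Measure.real, ENNReal.ofReal_toReal (measure_ne_top _ _)]
    have hone : (1 : ℝ≥0∞) = ENNReal.ofReal 1 := by simp
    rw [hD, hCr, hCdef, hone, ← ENNReal.ofReal_add zero_le_one hc.le,
      ← ENNReal.ofReal_add zero_le_one (by positivity), ← ENNReal.ofReal_pow (by positivity),
      ← ENNReal.ofReal_pow (by positivity), ← ENNReal.ofReal_mul (by positivity)]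
    refine ENNReal.ofReal_le_ofReal ?_
    rw [← Real.exp_log (show 0 < 1 + c by positivity),
      ← Real.exp_log (show 0 < 1 + c / p.real (B a) by positivity), ← Real.exp_nat_mul,
      ← Real.exp_nat_mul, ← Real.exp_add]
    refine Real.exp_le_exp.2 ?_
    have hlog : 0 ≤ Real.log (1 + c / p.real (B a)) :=
      Real.log_nonneg (by have : 0 ≤ c / p.real (B a) := by positivity
                          linarith)
    calc n * Real.log (1 + c) + 2 * n * ε ^ 2 = n * (Real.log (1 + c) + 2 * ε ^ 2) := by ring
      _ ≤ n * ((p.real (B a) + ε) * Real.log (1 + c / p.real (B a))) := by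
        gcongr
        exact hcr _ hr
      _ = n * (p.real (B a) + ε) * Real.log (1 + c / p.real (B a)) := by ring
      _ ≤ _ := by gcongr
  have hsum : D * (Measure.pi fun _ : Fin n => p) (⋃ a ∈ s, F a) ≤ (1 + C) ^ n := by
    calc D * (Measure.pi fun _ : Fin n => p) (⋃ a ∈ s, F a)
        = ∑ a ∈ s, D * (Measure.pi fun _ : Fin n => p) (F a) := by
          rw [measure_biUnion_finset hdisj fun a _ => hFm a, Finset.mul_sum]
      _ ≤ ∑ a ∈ s, (Measure.pi fun _ : Fin n => tilt p C (B m)) (F a) :=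
          Finset.sum_le_sum hstep
      _ = (Measure.pi fun _ : Fin n => tilt p C (B m)) (⋃ a ∈ s, F a) :=
          (measure_biUnion_finset hdisj fun a _ => hFm a).symm
      _ ≤ (Measure.pi fun _ : Fin n => tilt p C (B m)) Set.univ := measure_mono (Set.subset_univ _)
      _ = (1 + C) ^ n := by
          rw [Measure.pi_univ, tilt_apply_of_subset p C MeasurableSet.univ (hB m)
            (Set.subset_univ _) (hpos m hms)]
          simp
  refine (measure_mono hcover).trans ?_
  have hC0 : (1 + C) ^ n ≠ 0 := pow_ne_zero _ (by simp)
  have hCt : (1 + C) ^ n ≠ ∞ := ENNReal.pow_ne_top (by simp [hCtop])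
  rw [hD, mul_assoc] at hsum
  have hsum' : ENNReal.ofReal (Real.exp (2 * n * ε ^ 2)) *
      (Measure.pi fun _ : Fin n => p) (⋃ a ∈ s, F a) ≤ 1 := by
    rwa [← ENNReal.mul_le_mul_iff_right hC0 hCt, mul_one]
  rw [Real.exp_neg, ENNReal.ofReal_inv_of_pos (Real.exp_pos _)]
  rw [mul_comm] at hsum'
  simpa using (ENNReal.le_div_iff_mul_le (by simp [Real.exp_pos]) (by simp)).2 hsum'

end DKW

section KolmogorovSmirnov

open scoped ENNReal

/-- The one-sided Dvoretzky–Kiefer–Wolfowitz inequality over a countable chain of sets. -/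
theorem measure_exists_mem_countable_chain_le {E : Type*} [MeasurableSpace E] {α : Type*}
    [LinearOrder α] (p : Measure E) [IsProbabilityMeasure p] {B : α → Set E}
    (hB : ∀ a, MeasurableSet (B a)) (hmono : Monotone B) {n : ℕ} (hn : 0 < n) {ε : ℝ}
    (hε : 0 < ε) [Countable α] :
    (Measure.pi fun _ : Fin n => p) {x | ∃ a, (n : ℝ) * (p.real (B a) + ε) ≤
        ((Finset.univ.filter fun i => x i ∈ B a).card : ℝ)} ≤
      ENNReal.ofReal (Real.exp (-(2 * n * ε ^ 2))) := by
  have hn' : (0 : ℝ) < n := by exact_mod_cast hn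
  let β := {a : α // p (B a) ≠ 0}
  let X : Finset β → Set (Fin n → E) := fun s => {x | ∃ a ∈ s, (n : ℝ) * (p.real (B a) + ε) ≤
        ((Finset.univ.filter fun i => x i ∈ B a).card : ℝ)}
  have hnull : (Measure.pi fun _ : Fin n => p)
      (⋃ (a : {a : α // p (B a) = 0}) (i : Fin n), (fun x => x i) ⁻¹' B a) = 0 := by
    refine measure_iUnion_null fun a => measure_iUnion_null fun i => ?_
    exact ((measurePreserving_eval (fun _ : Fin n => p) i).measure_preimage
      (hB a).nullMeasurableSet).trans a.2
  have hsub : {x | ∃ a, (n : ℝ) * (p.real (B a) + ε) ≤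
        ((Finset.univ.filter fun i => x i ∈ B a).card : ℝ)} ⊆
      (⋃ (a : {a : α // p (B a) = 0}) (i : Fin n), (fun x => x i) ⁻¹' B a) ∪ ⋃ s, X s := by
    rintro x ⟨a, ha⟩
    by_cases h0 : p (B a) = 0
    · left
      have hr : p.real (B a) = 0 := by simp [Measure.real, h0]
      have hpos : (0 : ℝ) < ((Finset.univ.filter fun i => x i ∈ B a).card : ℝ) := by
        refine lt_of_lt_of_le ?_ ha
        rw [hr]
        positivity
      obtain ⟨i, hi⟩ := Finset.card_pos.1 (by exact_mod_cast hpos)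
      exact Set.mem_iUnion₂.2 ⟨⟨a, h0⟩, i, (Finset.mem_filter.1 hi).2⟩
    · right
      exact Set.mem_iUnion.2 ⟨{⟨a, h0⟩}, ⟨a, h0⟩, Finset.mem_singleton_self _, ha⟩
  refine (measure_mono hsub).trans ((measure_union_le _ _).trans ?_)
  have hdir : Directed (· ⊆ ·) X := by
    refine Monotone.directed_le fun s t hst x hx => ?_
    obtain ⟨a, ha, hxa⟩ := hx
    exact ⟨a, hst ha, hxa⟩
  rw [hnull, zero_add, hdir.measure_iUnion]
  exact iSup_le fun s => measure_exists_mem_chain_le p (B := fun a : β => B a) (fun a => hB a)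
    (fun a b hab => hmono hab) hε s fun a _ => a.2

theorem exists_rat_forall_le_iff {n : ℕ} (x : Fin n → ℝ) (a : ℝ) :
    ∃ b : ℚ, a < b ∧ ∀ i, x i ≤ b ↔ x i ≤ a := by
  have h : ∀ i, ∃ c, a < c ∧ ∀ b, a < b → b < c → (x i ≤ b ↔ x i ≤ a) := by
    intro i
    rcases le_or_gt (x i) a with hi | hi
    · exact ⟨a + 1, by linarith, fun b hb _ => iff_of_true (hi.trans hb.le) hi⟩
    · exact ⟨x i, hi, fun b _ hb => iff_of_false hb.not_ge hi.not_ge⟩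
  choose c hc hcb using h
  obtain ⟨d, hd, hdc⟩ : ∃ d, a < d ∧ ∀ i, d ≤ c i := by
    rcases isEmpty_or_nonempty (Fin n) with he | he
    · exact ⟨a + 1, by linarith, fun i => he.elim i⟩
    · obtain ⟨j, hj⟩ := Finite.exists_min c
      exact ⟨c j, hc j, hj⟩
  obtain ⟨b, hab, hbd⟩ := exists_rat_btwn hd
  exact ⟨b, hab, fun i => hcb i b hab (hbd.trans_le (hdc i))⟩

theorem exists_rat_cdfOf_lt (p : Measure ℝ) [IsProbabilityMeasure p] (a : ℝ) {r : ℝ}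
    (h : cdfOf p a < r) : ∃ b : ℚ, a < b ∧ cdfOf p b < r := by
  have he : ∀ x, cdfOf p x = ProbabilityTheory.cdf p x := fun x =>
    (ProbabilityTheory.cdf_eq_real p x).symm
  have hc := (ProbabilityTheory.cdf p).right_continuous a
  have hev := (hc.mono Set.Ioi_subset_Ici_self).eventually_lt_const (he a ▸ h)
  obtain ⟨u, hu, hsub⟩ := (mem_nhdsGT_iff_exists_Ioo_subset).1 hev
  obtain ⟨b, hab, hbu⟩ := exists_rat_btwn (Set.mem_Ioi.1 hu)
  exact ⟨b, hab, (he b).symm ▸ hsub ⟨hab, hbu⟩⟩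

theorem cdfOf_mono (p : Measure ℝ) [IsProbabilityMeasure p] : Monotone (cdfOf p) := fun _ _ h =>
  ENNReal.toReal_mono (measure_ne_top _ _) (measure_mono (Set.Iic_subset_Iic.2 h))

theorem empCDF_mono {n : ℕ} (x : Fin n → ℝ) : Monotone (empCDF x) := by
  intro a b hab
  unfold empCDF
  gcongr

/-- The Dvoretzky–Kiefer–Wolfowitz inequality. -/
theorem measure_exists_lt_abs_empCDF_sub_cdfOf_le (p : Measure ℝ) [IsProbabilityMeasure p] {n : ℕ}
    (hn : 0 < n) {ε : ℝ} (hε : 0 < ε) :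
    (Measure.pi fun _ : Fin n => p) {x | ∃ a, ε < |empCDF x a - cdfOf p a|} ≤
      ENNReal.ofReal (2 * Real.exp (-(2 * n * ε ^ 2))) := by
  have hn' : (0 : ℝ) < n := by exact_mod_cast hn
  have hup := measure_exists_mem_countable_chain_le p (B := fun b : ℚ => Set.Iic (b : ℝ))
    (fun _ => measurableSet_Iic) (fun a b hab => Set.Iic_subset_Iic.2 (by exact_mod_cast hab))
    hn hε
  have : Countable ℚᵒᵈ := OrderDual.ofDual.injective.countable
  have hdown := measure_exists_mem_countable_chain_le p
    (B := fun b : ℚᵒᵈ => Set.Ioi ((OrderDual.ofDual b : ℚ) : ℝ))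
    (fun _ => measurableSet_Ioi)
    (fun a b hab => Set.Ioi_subset_Ioi (by exact_mod_cast OrderDual.ofDual_le_ofDual.2 hab))
    hn hε
  rw [two_mul, ENNReal.ofReal_add (Real.exp_pos _).le (Real.exp_pos _).le]
  refine (measure_mono ?_).trans ((measure_union_le _ _).trans (add_le_add hup hdown))
  rintro x ⟨a, ha⟩
  rcases lt_abs.1 ha with h | h
  · left
    obtain ⟨b, hab, hb⟩ := exists_rat_cdfOf_lt p a (lt_sub_comm.1 h)
    refine ⟨b, ?_⟩
    have h1 : cdfOf p b + ε ≤ empCDF x b := by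
      have := empCDF_mono x hab.le
      linarith
    have h2 := (le_div_iff₀' hn').1 h1
    simpa [cdfOf, Measure.real] using h2
  · right
    obtain ⟨b, hab, hb⟩ := exists_rat_forall_le_iff x a
    refine ⟨OrderDual.toDual b, ?_⟩
    have h1 : empCDF x b + ε ≤ cdfOf p b := by
      have h3 := cdfOf_mono p hab.le
      have h4 : empCDF x b = empCDF x a := by simp only [empCDF, hb]
      linarith
    have h5 : p.real (Set.Ioi (b : ℝ)) = 1 - cdfOf p b := by
      rw [← Set.compl_Iic, probReal_compl_eq_one_sub measurableSet_Iic]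
      rfl
    have h6 : ((Finset.univ.filter fun i => x i ∈ Set.Ioi (b : ℝ)).card : ℝ) =
        n * (1 - empCDF x b) := by
      have := Finset.card_filter_add_card_filter_not (s := Finset.univ) (fun i => x i ≤ (b : ℝ))
      rw [Finset.card_univ, Fintype.card_fin] at this
      have h7 : (n : ℝ) = ((Finset.univ.filter fun i => x i ≤ (b : ℝ)).card : ℝ) +
          ((Finset.univ.filter fun i => ¬ x i ≤ (b : ℝ)).card : ℝ) := by exact_mod_cast this.symm
      simp only [Set.mem_Ioi, ← not_le]
      rw [empCDF, mul_sub, mul_div_cancel₀ _ hn'.ne']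
      linarith
    have h7 : (n : ℝ) * (p.real (Set.Ioi (b : ℝ)) + ε) ≤
        ((Finset.univ.filter fun i => x i ∈ Set.Ioi (b : ℝ)).card : ℝ) := by
      rw [h5, h6]
      gcongr
      linarith
    convert h7 <;> rfl

theorem cdfOf_mem_Icc (p : Measure ℝ) [IsProbabilityMeasure p] (a : ℝ) :
    cdfOf p a ∈ Set.Icc (0 : ℝ) 1 :=
  ⟨ENNReal.toReal_nonneg, ENNReal.toReal_le_of_le_ofReal zero_le_one (by simpa using prob_le_one)⟩

theorem empCDF_mem_Icc {n : ℕ} (x : Fin n → ℝ) (a : ℝ) : empCDF x a ∈ Set.Icc (0 : ℝ) 1 := by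
  refine ⟨by unfold empCDF; positivity, div_le_one_of_le₀ ?_ (by positivity)⟩
  exact_mod_cast (Finset.card_le_univ _).trans_eq (Fintype.card_fin n)

theorem abs_cdfOf_sub_le_one (p q : Measure ℝ) [IsProbabilityMeasure p] [IsProbabilityMeasure q]
    (a : ℝ) : |cdfOf p a - cdfOf q a| ≤ 1 := by
  obtain ⟨h1, h2⟩ := cdfOf_mem_Icc p a
  obtain ⟨h3, h4⟩ := cdfOf_mem_Icc q a
  exact abs_le.2 ⟨by linarith, by linarith⟩

theorem abs_empCDF_sub_le_one {n : ℕ} (x y : Fin n → ℝ) (a : ℝ) :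
    |empCDF x a - empCDF y a| ≤ 1 := by
  obtain ⟨h1, h2⟩ := empCDF_mem_Icc x a
  obtain ⟨h3, h4⟩ := empCDF_mem_Icc y a
  exact abs_le.2 ⟨by linarith, by linarith⟩

theorem ksDist_nonneg (p q : Measure ℝ) : 0 ≤ ksDist p q := Real.iSup_nonneg fun _ => abs_nonneg _

theorem ksDist_le_one (p q : Measure ℝ) [IsProbabilityMeasure p] [IsProbabilityMeasure q] :
    ksDist p q ≤ 1 := ciSup_le (abs_cdfOf_sub_le_one p q)

theorem abs_ksDistSeq_sub_ksDist_le {n : ℕ} {x y : Fin n → ℝ} {p q : Measure ℝ}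
    [IsProbabilityMeasure p] [IsProbabilityMeasure q] {ε : ℝ}
    (hx : ∀ a, |empCDF x a - cdfOf p a| ≤ ε) (hy : ∀ a, |empCDF y a - cdfOf q a| ≤ ε) :
    |ksDistSeq x y - ksDist p q| ≤ 2 * ε := by
  have b1 : BddAbove (Set.range fun a => |empCDF x a - empCDF y a|) :=
    ⟨1, Set.forall_mem_range.2 (abs_empCDF_sub_le_one x y)⟩
  have b2 : BddAbove (Set.range fun a => |cdfOf p a - cdfOf q a|) :=
    ⟨1, Set.forall_mem_range.2 (abs_cdfOf_sub_le_one p q)⟩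
  have key : ∀ a, |(empCDF x a - empCDF y a) - (cdfOf p a - cdfOf q a)| ≤ 2 * ε := by
    intro a
    obtain ⟨h1, h2⟩ := abs_le.1 (hx a)
    obtain ⟨h3, h4⟩ := abs_le.1 (hy a)
    exact abs_le.2 ⟨by linarith, by linarith⟩
  refine abs_le.2 ⟨?_, ?_⟩
  · rw [neg_le_sub_iff_le_add, ksDist]
    refine ciSup_le fun a => ?_
    have h1 := le_ciSup b1 a
    have h2 := abs_sub_abs_le_abs_sub (cdfOf p a - cdfOf q a) (empCDF x a - empCDF y a)
    rw [abs_sub_comm (cdfOf p a - cdfOf q a) (empCDF x a - empCDF y a)] at h2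
    have h3 := key a
    simp only [ksDistSeq] at h1 ⊢
    linarith
  · rw [sub_le_iff_le_add, ksDistSeq]
    refine ciSup_le fun a => ?_
    have h1 := le_ciSup b2 a
    have h2 := abs_sub_abs_le_abs_sub (empCDF x a - empCDF y a) (cdfOf p a - cdfOf q a)
    have h3 := key a
    simp only [ksDist] at h1 ⊢
    linarith

/-- Error probability of Algorithm 4 with the KS distance, for sequences indexed by `ι`. -/
theorem measure_not_correctClustering_alg4_ks_le {ι κ : Type*} [Fintype ι] [DecidableEq ι]
    (gen : ι → κ) (P : κ → Set (Measure ℝ)) (hP : ∀ k, ∀ p ∈ P k, IsProbabilityMeasure p)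
    {dL dH : ℝ}
    (hdL : sSup {r : ℝ | ∃ k, ∃ p ∈ P k, ∃ q ∈ P k, r = ksDist p q} = dL)
    (hdH : sInf {r : ℝ | ∃ k k', k ≠ k' ∧ ∃ p ∈ P k, ∃ q ∈ P k', r = ksDist p q} = dH)
    (h : dL < dH) {n : ℕ} (q : ι → Measure ℝ) (hq : ∀ i, q i ∈ P (gen i)) (i₀ : ι) (T : ℕ) :
    (Measure.pi fun i => Measure.pi fun _ : Fin n => q i)
      {ω | ¬ CorrectClustering gen (alg4 ω (fun x y => ksDistSeq x y) ((dH + dL) / 2) i₀ T)} ≤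
    ENNReal.ofReal ((Fintype.card ι : ℝ) ^ 2 * (10 * (T : ℝ) + 14) *
      Real.exp (-((n : ℝ) * (dH - dL) ^ 2 / 8))) := by
  have hprob : ∀ i, IsProbabilityMeasure (q i) := fun i => hP _ _ (hq i)
  have hM : (1 : ℝ) ≤ Fintype.card ι := by exact_mod_cast Fintype.card_pos_iff.2 ⟨i₀⟩
  have hT : (0 : ℝ) ≤ T := Nat.cast_nonneg T
  rcases Nat.eq_zero_or_pos n with rfl | hn
  · refine prob_le_one.trans (ENNReal.one_le_ofReal.2 ?_)
    simp only [Nat.cast_zero, zero_mul, zero_div, neg_zero, Real.exp_zero, mul_one]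
    nlinarith
  have hwithin : ∀ i j, gen i = gen j → ksDist (q i) (q j) ≤ dL := by
    intro i j hij
    rw [← hdL]
    refine le_csSup ⟨1, ?_⟩ ⟨gen i, q i, hq i, q j, hij ▸ hq j, rfl⟩
    rintro r ⟨k, p, hp, p', hp', rfl⟩
    have := hP _ _ hp
    have := hP _ _ hp'
    exact ksDist_le_one p p'
  have hacross : ∀ i j, gen i ≠ gen j → dH ≤ ksDist (q i) (q j) := by
    intro i j hij
    rw [← hdH]
    refine csInf_le ⟨0, ?_⟩ ⟨gen i, gen j, hij, q i, hq i, q j, hq j, rfl⟩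
    rintro r ⟨k, k', -, p, -, p', -, rfl⟩
    exact ksDist_nonneg p p'
  obtain ⟨ε, hε, hε4, hexp⟩ : ∃ ε, 0 < ε ∧ ε < (dH - dL) / 4 ∧
      Real.exp (-(2 * n * ε ^ 2)) < 2 * Real.exp (-((n : ℝ) * (dH - dL) ^ 2 / 8)) := by
    have hc : ContinuousAt (fun ε : ℝ => Real.exp (-(2 * n * ε ^ 2))) ((dH - dL) / 4) := by fun_prop
    have h1 : Real.exp (-(2 * n * ((dH - dL) / 4) ^ 2)) <
        2 * Real.exp (-((n : ℝ) * (dH - dL) ^ 2 / 8)) := by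
      rw [show -(2 * n * ((dH - dL) / 4) ^ 2) = -((n : ℝ) * (dH - dL) ^ 2 / 8) by ring]
      linarith [Real.exp_pos (-((n : ℝ) * (dH - dL) ^ 2 / 8))]
    have h2 := (hc.eventually_lt_const h1).filter_mono (nhdsWithin_le_nhds (s := Set.Iio ((dH - dL) / 4)))
    have h3 : ∀ᶠ ε in nhdsWithin ((dH - dL) / 4) (Set.Iio ((dH - dL) / 4)), 0 < ε :=
      (eventually_gt_nhds (by linarith)).filter_mono nhdsWithin_le_nhds
    obtain ⟨ε, ⟨ha, hb⟩, hc⟩ := ((h2.and h3).and self_mem_nhdsWithin).exists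
    exact ⟨ε, hb, hc, ha⟩
  let X : ι → Set (Fin n → ℝ) := fun i => {x | ∃ a, ε < |empCDF x a - cdfOf (q i) a|}
  have hsub : {ω | ¬ CorrectClustering gen
      (alg4 ω (fun x y => ksDistSeq x y) ((dH + dL) / 2) i₀ T)} ⊆
      ⋃ i, (fun ω : ι → Fin n → ℝ => ω i) ⁻¹' X i := by
    intro ω hω
    by_contra hgood
    simp only [X, Set.mem_iUnion, Set.mem_preimage, Set.mem_ofPred_eq, not_exists, not_lt] at hgood
    refine hω (correctClustering_alg4 (fun i j => ?_) i₀ T)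
    obtain ⟨h1, h2⟩ := abs_le.1 (abs_ksDistSeq_sub_ksDist_le (hgood i) (hgood j))
    refine ⟨fun hle => ?_, fun hij => ?_⟩
    · by_contra hij
      have := hacross i j hij
      linarith
    · have := hwithin i j hij
      linarith
  have hX : ∀ i, (Measure.pi fun i => Measure.pi fun _ : Fin n => q i)
      ((fun ω : ι → Fin n → ℝ => ω i) ⁻¹' X i) ≤
      ENNReal.ofReal (2 * Real.exp (-(2 * n * ε ^ 2))) := fun i => by
    have hmp := measurePreserving_eval (fun i => Measure.pi fun _ : Fin n => q i) i
    refine (Measure.le_map_apply hmp.measurable.aemeasurable _).trans ?_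
    rw [hmp.map_eq]
    exact measure_exists_lt_abs_empCDF_sub_cdfOf_le (q i) hn hε
  calc _ ≤ ∑ i, (Measure.pi fun i => Measure.pi fun _ : Fin n => q i)
        ((fun ω : ι → Fin n → ℝ => ω i) ⁻¹' X i) :=
        (measure_mono hsub).trans (measure_iUnion_fintype_le _ _)
    _ ≤ ∑ _i : ι, ENNReal.ofReal (2 * Real.exp (-(2 * n * ε ^ 2))) :=
        Finset.sum_le_sum fun i _ => hX i
    _ = ENNReal.ofReal (Fintype.card ι * (2 * Real.exp (-(2 * n * ε ^ 2)))) := by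
        rw [Finset.sum_const, Finset.card_univ, nsmul_eq_mul,
          ENNReal.ofReal_mul (Nat.cast_nonneg _), ENNReal.ofReal_natCast]
    _ ≤ _ := by
        refine ENNReal.ofReal_le_ofReal ?_
        have he := Real.exp_pos (-((n : ℝ) * (dH - dL) ^ 2 / 8))
        calc (Fintype.card ι : ℝ) * (2 * Real.exp (-(2 * n * ε ^ 2)))
            ≤ Fintype.card ι * (4 * Real.exp (-((n : ℝ) * (dH - dL) ^ 2 / 8))) :=
              mul_le_mul_of_nonneg_left (by linarith) (by positivity)
          _ = Fintype.card ι * 4 * Real.exp (-((n : ℝ) * (dH - dL) ^ 2 / 8)) := by ring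
          _ ≤ (Fintype.card ι : ℝ) ^ 2 * (10 * (T : ℝ) + 14) *
              Real.exp (-((n : ℝ) * (dH - dL) ^ 2 / 8)) := by
              gcongr
              · nlinarith
              · linarith

end KolmogorovSmirnov

section BoundedDifferences

open scoped NNReal
open ProbabilityTheory

theorem hasSubgaussianMGF_prod {α β : Type*} [MeasurableSpace α] [MeasurableSpace β]
    {μ : Measure α} {ν : Measure β} [IsProbabilityMeasure μ] [IsProbabilityMeasure ν]
    {f : α × β → ℝ} (hf : Measurable f) {C : ℝ} (hC : ∀ z, |f z| ≤ C) {v w : ℝ≥0}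
    (hfst : ∀ b, HasSubgaussianMGF (fun a => f (a, b) - ∫ a', f (a', b) ∂μ) v μ)
    (hsnd : HasSubgaussianMGF (fun b => ∫ a, f (a, b) ∂μ - ∫ z, f z ∂μ.prod ν) w ν) :
    HasSubgaussianMGF (fun z => f z - ∫ z, f z ∂μ.prod ν) (v + w) (μ.prod ν) := by
  set M := ∫ z, f z ∂μ.prod ν
  have hintegrable : ∀ t : ℝ, Integrable (fun z => Real.exp (t * (f z - M))) (μ.prod ν) := fun t =>
    integrable_exp_mul_of_mem_Icc (a := -C - M) (b := C - M) (hf.sub_const M).aemeasurable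
      (.of_forall fun z => by
        obtain ⟨h1, h2⟩ := abs_le.1 (hC z)
        exact ⟨by linarith, by linarith⟩)
  refine ⟨hintegrable, fun t => ?_⟩
  have hstep : ∀ b, ∫ a, Real.exp (t * (f (a, b) - M)) ∂μ ≤
      Real.exp (v * t ^ 2 / 2) * Real.exp (t * (∫ a, f (a, b) ∂μ - M)) := by
    intro b
    have h1 : ∀ a, Real.exp (t * (f (a, b) - M)) =
        Real.exp (t * (f (a, b) - ∫ a', f (a', b) ∂μ)) *
          Real.exp (t * (∫ a, f (a, b) ∂μ - M)) := fun a => by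
      rw [← Real.exp_add]
      ring_nf
    simp only [h1]
    rw [integral_mul_const]
    exact mul_le_mul_of_nonneg_right ((hfst b).mgf_le t) (Real.exp_pos _).le
  calc mgf (fun z => f z - M) (μ.prod ν) t
      = ∫ b, ∫ a, Real.exp (t * (f (a, b) - M)) ∂μ ∂ν := integral_prod_symm _ (hintegrable t)
    _ ≤ ∫ b, Real.exp (v * t ^ 2 / 2) * Real.exp (t * (∫ a, f (a, b) ∂μ - M)) ∂ν :=
        integral_mono (hintegrable t).integral_prod_right ((hsnd.integrable_exp_mul t).const_mul _) hstep
    _ = Real.exp (v * t ^ 2 / 2) * mgf (fun b => ∫ a, f (a, b) ∂μ - M) ν t :=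
        integral_const_mul _ _
    _ ≤ Real.exp (v * t ^ 2 / 2) * Real.exp (w * t ^ 2 / 2) :=
        mul_le_mul_of_nonneg_left (hsnd.mgf_le t) (Real.exp_pos _).le
    _ = Real.exp ((v + w : ℝ≥0) * t ^ 2 / 2) := by
        rw [← Real.exp_add]
        push_cast
        ring_nf

theorem hasSubgaussianMGF_of_abs_sub_le {α : Type*} [MeasurableSpace α] {μ : Measure α}
    [IsProbabilityMeasure μ] {f : α → ℝ} (hf : Measurable f) {c : ℝ≥0}
    (hc : ∀ a a', |f a - f a'| ≤ c) :
    HasSubgaussianMGF (fun a => f a - ∫ a, f a ∂μ) (c ^ 2) μ := by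
  obtain ⟨a₀⟩ := nonempty_of_isProbabilityMeasure μ
  have h := hasSubgaussianMGF_of_mem_Icc (μ := μ) (a := f a₀ - c) (b := f a₀ + c) hf.aemeasurable
    (.of_forall fun a => by
      obtain ⟨h1, h2⟩ := abs_le.1 (hc a a₀)
      exact ⟨by linarith, by linarith⟩)
  convert h using 2
  ext
  push_cast
  rw [Real.norm_eq_abs, show f a₀ + c - (f a₀ - c) = 2 * (c : ℝ) by ring,
    abs_of_nonneg (by positivity)]
  ring

/-- Changing one coordinate changes the value of `f` by at most `c`. -/
def BoundedDiff {E : Type*} {n : ℕ} (f : (Fin n → E) → ℝ) (c : ℝ) : Prop :=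
  ∀ x i e, |f (Function.update x i e) - f x| ≤ c

theorem abs_integral_sub_integral_le {α : Type*} [MeasurableSpace α] {μ : Measure α}
    [IsProbabilityMeasure μ] {f g : α → ℝ} (hf : Integrable f μ) (hg : Integrable g μ) {c : ℝ}
    (h : ∀ a, |f a - g a| ≤ c) : |∫ a, f a ∂μ - ∫ a, g a ∂μ| ≤ c := by
  rw [← integral_sub hf hg]
  simpa using norm_integral_le_of_norm_le_const (μ := μ) (f := fun a => f a - g a) (.of_forall h)

theorem abs_integral_le {α : Type*} [MeasurableSpace α] {μ : Measure α}
    [IsProbabilityMeasure μ] {f : α → ℝ} {C : ℝ} (h : ∀ a, |f a| ≤ C) : |∫ a, f a ∂μ| ≤ C := by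
  simpa using norm_integral_le_of_norm_le_const (μ := μ) (f := f) (.of_forall h)

theorem integrable_of_abs_le {α : Type*} [MeasurableSpace α] {μ : Measure α}
    [IsProbabilityMeasure μ] {f : α → ℝ} (hf : Measurable f) {C : ℝ} (h : ∀ a, |f a| ≤ C) :
    Integrable f μ :=
  Integrable.of_bound hf.aestronglyMeasurable C (.of_forall h)

/-- Functions of independent coordinates with bounded differences are sub-Gaussian. -/
theorem BoundedDiff.hasSubgaussianMGF {E : Type*} [MeasurableSpace E] {p : Measure E}
    [IsProbabilityMeasure p] {n : ℕ} {f : (Fin n → E) → ℝ} (hf : Measurable f) {C : ℝ}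
    (hC : ∀ x, |f x| ≤ C) {c : ℝ≥0} (hc : BoundedDiff f c) :
    HasSubgaussianMGF (fun x => f x - ∫ x, f x ∂Measure.pi fun _ : Fin n => p) (n * c ^ 2)
      (Measure.pi fun _ : Fin n => p) := by
  induction n with
  | zero =>
    have h := hasSubgaussianMGF_of_abs_sub_le (μ := Measure.pi fun _ : Fin 0 => p) hf (c := 0)
      fun x y => by simp [Subsingleton.elim x y]
    simpa using h
  | succ n ih =>
    let F : E × (Fin n → E) → ℝ := fun z => f (Fin.cons z.1 z.2)
    have hmp := measurePreserving_piFinSuccAbove (fun _ : Fin (n + 1) => p) 0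
    have hFf : ∀ x, F (MeasurableEquiv.piFinSuccAbove (fun _ => E) 0 x) = f x := fun x => by
      simp only [F]
      congr 1
      exact Fin.cons_self_tail x
    have hF : Measurable F := by
      have : F = f ∘ (MeasurableEquiv.piFinSuccAbove (fun _ => E) 0).symm := by
        ext z
        rw [Function.comp_apply, ← hFf, MeasurableEquiv.apply_symm_apply]
      rw [this]
      exact hf.comp (MeasurableEquiv.measurable _)
    have hFC : ∀ z, |F z| ≤ C := fun z => hC _
    have hfst : ∀ b, Measurable fun a => F (a, b) := fun b => hF.comp measurable_prodMk_right
    have h := hasSubgaussianMGF_prod (μ := p) (ν := Measure.pi fun _ : Fin n => p) hF hFC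
      (v := c ^ 2) (w := n * c ^ 2) (fun b => ?_) ?_
    · have hI : ∫ z, F z ∂(p.prod (Measure.pi fun _ : Fin n => p)) =
          ∫ x, f x ∂Measure.pi fun _ : Fin (n + 1) => p := by
        rw [← hmp.integral_comp' F]
        exact integral_congr_ae (.of_forall hFf)
      rw [hI] at h
      have hcomp := HasSubgaussianMGF.of_map hmp.measurable.aemeasurable (hmp.map_eq.symm ▸ h)
      convert hcomp using 1
      · ext x
        simp only [Function.comp_apply, hFf]
      · push_cast
        ring
    · refine hasSubgaussianMGF_of_abs_sub_le (hfst b) fun a a' => ?_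
      have := hc (Fin.cons a' b) 0 a
      rwa [Fin.update_cons_zero] at this
    · have hI : ∫ z, F z ∂(p.prod (Measure.pi fun _ : Fin n => p)) =
          ∫ b, ∫ a, F (a, b) ∂p ∂(Measure.pi fun _ : Fin n => p) :=
        integral_prod_symm _ (integrable_of_abs_le hF hFC)
      rw [hI]
      refine ih hF.stronglyMeasurable.integral_prod_left'.measurable
        (fun b => abs_integral_le fun a => hFC (a, b)) fun x i e => ?_
      refine abs_integral_sub_integral_le (integrable_of_abs_le (hfst _) fun a => hFC (a, _))
        (integrable_of_abs_le (hfst _) fun a => hFC (a, _)) fun a => ?_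
      have := hc (Fin.cons a x) i.succ e
      rwa [← Fin.cons_update] at this

/-- Bounded-difference concentration for functions of two independent samples. -/
theorem hasSubgaussianMGF_of_boundedDiff_prod {E : Type*} [MeasurableSpace E] {p q : Measure E}
    [IsProbabilityMeasure p] [IsProbabilityMeasure q] {n : ℕ}
    {f : (Fin n → E) × (Fin n → E) → ℝ} (hf : Measurable f) {C : ℝ} (hC : ∀ z, |f z| ≤ C)
    {c : ℝ≥0} (hfst : ∀ y, BoundedDiff (fun x => f (x, y)) c)
    (hsnd : ∀ x, BoundedDiff (fun y => f (x, y)) c) :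
    HasSubgaussianMGF
      (fun z => f z - ∫ z, f z ∂(Measure.pi fun _ : Fin n => p).prod (Measure.pi fun _ => q))
      (2 * n * c ^ 2) ((Measure.pi fun _ => p).prod (Measure.pi fun _ => q)) := by
  have hm : ∀ y, Measurable fun x => f (x, y) := fun y => hf.comp measurable_prodMk_right
  have h := hasSubgaussianMGF_prod (μ := Measure.pi fun _ : Fin n => p)
    (ν := Measure.pi fun _ : Fin n => q) hf hC
    (fun y => (hfst y).hasSubgaussianMGF (hm y) fun x => hC (x, y)) (w := n * c ^ 2) ?_
  · convert h using 1
    ring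
  · rw [integral_prod_symm _ (integrable_of_abs_le hf hC)]
    refine BoundedDiff.hasSubgaussianMGF hf.stronglyMeasurable.integral_prod_left'.measurable
      (fun y => abs_integral_le fun x => hC (x, y)) fun y i e => ?_
    exact abs_integral_sub_integral_le (integrable_of_abs_le (hm _) fun x => hC (x, _))
        (integrable_of_abs_le (hm _) fun x => hC (x, _)) fun x => hsnd x y i e

end BoundedDifferences

section MMDDeterministic

variable {E : Type*} {g : E → E → ℝ}

theorem abs_offDiag_sum_sub_le {n : ℕ} {D : Fin n → Fin n → ℝ} {b : ℝ} (k : Fin n)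
    (hD : ∀ i j, |D i j| ≤ b) (h0 : ∀ i j, i ≠ k → j ≠ k → D i j = 0) :
    |∑ i, ∑ j ∈ Finset.univ.erase i, D i j| ≤ 2 * ((n : ℝ) - 1) * b := by
  have hb : 0 ≤ b := (abs_nonneg _).trans (hD k k)
  have hn : 1 ≤ n := Nat.one_le_of_lt k.2
  have h1 : ∀ i j, |D i j| ≤ (if i = k then b else 0) + if j = k then b else 0 := by
    intro i j
    by_cases hi : i = k
    · rw [if_pos hi]
      have : 0 ≤ if j = k then b else 0 := by split_ifs <;> simp [hb]
      linarith [hD i j]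
    · by_cases hj : j = k
      · rw [if_neg hi, if_pos hj, zero_add]
        exact hD i j
      · rw [h0 i j hi hj]
        simp [hi, hj]
  calc |∑ i, ∑ j ∈ Finset.univ.erase i, D i j|
      ≤ ∑ i, ∑ j ∈ Finset.univ.erase i, |D i j| :=
        (Finset.abs_sum_le_sum_abs _ _).trans
          (Finset.sum_le_sum fun i _ => Finset.abs_sum_le_sum_abs _ _)
    _ ≤ ∑ i, ∑ j ∈ Finset.univ.erase i, ((if i = k then b else 0) + if j = k then b else 0) :=
        Finset.sum_le_sum fun i _ => Finset.sum_le_sum fun j _ => h1 i j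
    _ = ∑ i, (((n : ℝ) - 1) * (if i = k then b else 0) + if i ≠ k then b else 0) := by
        refine Finset.sum_congr rfl fun i _ => ?_
        rw [Finset.sum_add_distrib, Finset.sum_const, Finset.card_erase_of_mem (Finset.mem_univ i),
          Finset.card_univ, Fintype.card_fin, nsmul_eq_mul, Nat.cast_sub hn, Finset.sum_ite_eq']
        simp [eq_comm]
    _ = 2 * ((n : ℝ) - 1) * b := by
        rw [Finset.sum_add_distrib, ← Finset.mul_sum, Finset.sum_ite_eq' Finset.univ k,
          ← Finset.sum_filter, Finset.sum_const, Finset.filter_ne',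
          Finset.card_erase_of_mem (Finset.mem_univ k), Finset.card_univ, Fintype.card_fin,
          nsmul_eq_mul, Nat.cast_sub hn]
        simp
        ring

theorem abs_sum_sub_le_of_row {n m : ℕ} {D : Fin n → Fin m → ℝ} {b : ℝ} (k : Fin n)
    (hD : ∀ i j, |D i j| ≤ b) (h0 : ∀ i j, i ≠ k → D i j = 0) :
    |∑ i, ∑ j, D i j| ≤ m * b := by
  rw [Finset.sum_eq_single k (fun i _ hi => Finset.sum_eq_zero fun j _ => h0 i j hi) (by simp)]
  refine (Finset.abs_sum_le_sum_abs _ _).trans ((Finset.sum_le_sum fun j _ => hD k j).trans ?_)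
  simp

theorem mmdSqEst_comm (hsymm : ∀ a b, g a b = g b a) {n : ℕ} (x y : Fin n → E) :
    mmdSqEst g x y = mmdSqEst g y x := by
  simp only [mmdSqEst]
  rw [Finset.sum_comm (f := fun i j => g (x i) (y j))]
  simp only [hsymm (x _) (y _)]
  ring

theorem boundedDiff_mmdSqEst {b : ℝ} (hg : ∀ x y, 0 ≤ g x y ∧ g x y ≤ b) {n : ℕ} (hn : 2 ≤ n)
    (y : Fin n → E) : BoundedDiff (fun x : Fin n → E => mmdSqEst g x y) (4 * b / n) := by
  intro x k e
  have hn' : (2 : ℝ) ≤ n := by exact_mod_cast hn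
  have hdiff : ∀ a a' c c', |g a a' - g c c'| ≤ b := fun a a' c c' =>
    abs_le.2 ⟨by linarith [(hg a a').1, (hg c c').2], by linarith [(hg a a').2, (hg c c').1]⟩
  set x' := Function.update x k e with hx'
  have hxi : ∀ i, i ≠ k → x' i = x i := fun i hi => Function.update_of_ne hi e x
  have h1 := abs_offDiag_sum_sub_le (D := fun i j => g (x' i) (x' j) - g (x i) (x j)) k
    (fun i j => hdiff _ _ _ _) fun i j hi hj => by simp [hxi i hi, hxi j hj]
  have h2 := abs_sum_sub_le_of_row (D := fun i j => g (x' i) (y j) - g (x i) (y j)) k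
    (fun i j => hdiff _ _ _ _) fun i j hi => by simp [hxi i hi]
  simp only [Finset.sum_sub_distrib] at h1 h2
  have hd1 : (0 : ℝ) < n * (n - 1) := by nlinarith
  have hd2 : (0 : ℝ) < (n : ℝ) * n := by nlinarith
  simp only [mmdSqEst]
  set U' := ∑ i, ∑ j ∈ Finset.univ.erase i, g (x' i) (x' j)
  set U := ∑ i, ∑ j ∈ Finset.univ.erase i, g (x i) (x j)
  set W' := ∑ i, ∑ j, g (x' i) (y j)
  set W := ∑ i, ∑ j, g (x i) (y j)
  set V := ∑ i, ∑ j ∈ Finset.univ.erase i, g (y i) (y j)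
  calc |U' / (n * (n - 1)) + V / (n * (n - 1)) - 2 * W' / (n * n) -
        (U / (n * (n - 1)) + V / (n * (n - 1)) - 2 * W / (n * n))|
      = |(U' - U) / (n * (n - 1)) - 2 * ((W' - W) / (n * n))| := by
        congr 1
        ring
    _ ≤ |(U' - U) / (n * (n - 1))| + |2 * ((W' - W) / (n * n))| := abs_sub _ _
    _ = |U' - U| / (n * (n - 1)) + 2 * (|W' - W| / (n * n)) := by
        rw [abs_div, abs_mul (2 : ℝ), abs_div, abs_of_pos hd1, abs_of_pos hd2,
          abs_of_pos (zero_lt_two' ℝ)]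
    _ ≤ 2 * ((n : ℝ) - 1) * b / (n * (n - 1)) + 2 * (n * b / (n * n)) := by gcongr
    _ = 4 * b / n := by
        have : (n : ℝ) - 1 ≠ 0 := by linarith
        field_simp
        ring

theorem abs_mmdSqEst_le {b : ℝ} (hg : ∀ x y, 0 ≤ g x y ∧ g x y ≤ b) {n : ℕ} (hn : 2 ≤ n)
    (x y : Fin n → E) : |mmdSqEst g x y| ≤ 2 * b := by
  have hn' : (2 : ℝ) ≤ n := by exact_mod_cast hn
  have hd1 : (0 : ℝ) < n * (n - 1) := by nlinarith
  have hd2 : (0 : ℝ) < (n : ℝ) * n := by nlinarith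
  have hU : ∀ z : Fin n → E,
      0 ≤ (∑ i, ∑ j ∈ Finset.univ.erase i, g (z i) (z j)) / (n * ((n : ℝ) - 1)) ∧
      (∑ i, ∑ j ∈ Finset.univ.erase i, g (z i) (z j)) / (n * ((n : ℝ) - 1)) ≤ b := by
    intro z
    refine ⟨div_nonneg (Finset.sum_nonneg fun i _ => Finset.sum_nonneg fun j _ => (hg _ _).1)
      hd1.le, (div_le_iff₀ hd1).2 ?_⟩
    refine (Finset.sum_le_sum fun i _ => Finset.sum_le_sum fun j _ => (hg (z i) (z j)).2).trans ?_
    simp only [Finset.sum_const, Finset.card_erase_of_mem (Finset.mem_univ _), Finset.card_univ,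
      Fintype.card_fin, nsmul_eq_mul, Nat.cast_sub (one_le_two.trans hn), Nat.cast_one]
    linarith
  have hW : 0 ≤ 2 * (∑ i, ∑ j, g (x i) (y j)) / ((n : ℝ) * n) ∧
      2 * (∑ i, ∑ j, g (x i) (y j)) / ((n : ℝ) * n) ≤ 2 * b := by
    refine ⟨div_nonneg (mul_nonneg two_pos.le
      (Finset.sum_nonneg fun i _ => Finset.sum_nonneg fun j _ => (hg _ _).1))
      hd2.le, (div_le_iff₀ hd2).2 ?_⟩
    have : ∑ i, ∑ j, g (x i) (y j) ≤ ∑ _i : Fin n, ∑ _j : Fin n, b :=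
      Finset.sum_le_sum fun i _ => Finset.sum_le_sum fun j _ => (hg (x i) (y j)).2
    simp only [Finset.sum_const, Finset.card_univ, Fintype.card_fin, nsmul_eq_mul] at this
    linarith
  have := hU x
  have := hU y
  exact abs_le.2 ⟨by simp only [mmdSqEst]; linarith, by simp only [mmdSqEst]; linarith⟩

theorem mmdSqEst_self_nonpos (hdiag : ∀ a b, 2 * g a b ≤ g a a + g b b) {n : ℕ} (hn : 2 ≤ n)
    (x : Fin n → E) : mmdSqEst g x x ≤ 0 := by
  have hn' : (2 : ℝ) ≤ n := by exact_mod_cast hn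
  have hn1 : (0 : ℝ) < n - 1 := by linarith
  have hsplit : ∑ i, ∑ j, g (x i) (x j) =
      ∑ i, ∑ j ∈ Finset.univ.erase i, g (x i) (x j) + ∑ i, g (x i) (x i) := by
    rw [← Finset.sum_add_distrib]
    exact Finset.sum_congr rfl fun i _ => (Finset.sum_erase_add _ _ (Finset.mem_univ i)).symm
  have hle : 2 * ∑ i, ∑ j, g (x i) (x j) ≤ 2 * n * ∑ i, g (x i) (x i) := by
    calc 2 * ∑ i, ∑ j, g (x i) (x j) = ∑ i, ∑ j, 2 * g (x i) (x j) := by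
          simp only [Finset.mul_sum]
      _ ≤ ∑ i, ∑ j, (g (x i) (x i) + g (x j) (x j)) :=
          Finset.sum_le_sum fun i _ => Finset.sum_le_sum fun j _ => hdiag _ _
      _ = 2 * n * ∑ i, g (x i) (x i) := by
          simp only [Finset.sum_add_distrib, Finset.sum_const, Finset.card_univ, Fintype.card_fin,
            nsmul_eq_mul, ← Finset.mul_sum]
          ring
  simp only [mmdSqEst]
  rw [hsplit] at hle ⊢
  set U := ∑ i, ∑ j ∈ Finset.univ.erase i, g (x i) (x j)
  set D := ∑ i, g (x i) (x i)
  have : U / (n * (n - 1)) + U / (n * (n - 1)) - 2 * (U + D) / (n * n) =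
      2 * (U - (n - 1) * D) / (n * n * (n - 1)) := by
    field_simp
    ring
  rw [this]
  exact div_nonpos_of_nonpos_of_nonneg (by linarith) (by positivity)

end MMDDeterministic

section MMDConcentration

open scoped NNReal
open ProbabilityTheory

theorem measurePreserving_eval_prodMk {ι : Type*} [Fintype ι] {X : ι → Type*}
    [∀ i, MeasurableSpace (X i)] (μ : ∀ i, Measure (X i)) [∀ i, IsProbabilityMeasure (μ i)]
    {i j : ι} (hij : i ≠ j) :
    MeasurePreserving (fun x : ∀ i, X i => (x i, x j)) (Measure.pi μ) ((μ i).prod (μ j)) := by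
  refine ⟨(measurable_pi_apply i).prodMk (measurable_pi_apply j), ?_⟩
  have h := (iIndepFun_pi (μ := μ) (X := fun i (x : X i) => x)
    fun i => measurable_id.aemeasurable).indepFun hij
  rw [(indepFun_iff_map_prod_eq_prod_map_map (measurable_pi_apply i).aemeasurable
    (measurable_pi_apply j).aemeasurable).1 h, (measurePreserving_eval μ i).map_eq,
    (measurePreserving_eval μ j).map_eq]

theorem abs_inner_le_of_inner_self_le {E H : Type*} [NormedAddCommGroup H]
    [InnerProductSpace ℝ H] {φ : E → H} {b : ℝ}
    (hb : ∀ x, inner ℝ (φ x) (φ x) ≤ b) (x y : E) : |inner ℝ (φ x) (φ y)| ≤ b := by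
  have h1 := abs_real_inner_le_norm (φ x) (φ y)
  have h2 := hb x
  have h3 := hb y
  rw [real_inner_self_eq_norm_sq] at h2 h3
  nlinarith [sq_nonneg (‖φ x‖ - ‖φ y‖)]

variable {E : Type*} [MeasurableSpace E] {H : Type*} [NormedAddCommGroup H]
  [InnerProductSpace ℝ H]

theorem integrable_of_inner_self_le {φ : E → H} (hφ : StronglyMeasurable φ) {b : ℝ}
    (hb : ∀ x, inner ℝ (φ x) (φ x) ≤ b) (p : Measure E) [IsFiniteMeasure p] : Integrable φ p := by
  refine Integrable.of_bound hφ.aestronglyMeasurable (√b) (.of_forall fun x => ?_)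
  refine Real.le_sqrt_of_sq_le ?_
  rw [← real_inner_self_eq_norm_sq]
  exact hb x

theorem integral_inner_prod [CompleteSpace H] {φ : E → H} (hφ : StronglyMeasurable φ) {b : ℝ}
    (hb : ∀ x, inner ℝ (φ x) (φ x) ≤ b) (p q : Measure E) [IsProbabilityMeasure p]
    [IsProbabilityMeasure q] :
    ∫ z, inner ℝ (φ z.1) (φ z.2) ∂p.prod q = inner ℝ (∫ x, φ x ∂p) (∫ x, φ x ∂q) := by
  have hm : StronglyMeasurable fun z : E × E => inner ℝ (φ z.1) (φ z.2) :=
    (hφ.comp_measurable measurable_fst).inner (hφ.comp_measurable measurable_snd)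
  rw [integral_prod _ (integrable_of_abs_le hm.measurable fun z =>
    abs_inner_le_of_inner_self_le hb z.1 z.2)]
  simp only [integral_inner (integrable_of_inner_self_le hφ hb q)]
  simp only [real_inner_comm (∫ x, φ x ∂q)]
  rw [integral_inner (integrable_of_inner_self_le hφ hb p), real_inner_comm]

theorem measurable_inner_comp {φ : E → H} (hφ : StronglyMeasurable φ) {α : Type*}
    [MeasurableSpace α] {u v : α → E} (hu : Measurable u) (hv : Measurable v) :
    Measurable fun a => inner ℝ (φ (u a)) (φ (v a)) :=
  ((hφ.comp_measurable hu).inner (hφ.comp_measurable hv)).measurable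

theorem measurable_mmdSqEst {φ : E → H} (hφ : StronglyMeasurable φ) (n : ℕ) :
    Measurable fun z : (Fin n → E) × (Fin n → E) =>
      mmdSqEst (fun x y => inner ℝ (φ x) (φ y)) z.1 z.2 := by
  have h1 : ∀ i, Measurable fun z : (Fin n → E) × (Fin n → E) => z.1 i := fun i =>
    (measurable_pi_apply i).comp measurable_fst
  have h2 : ∀ i, Measurable fun z : (Fin n → E) × (Fin n → E) => z.2 i := fun i =>
    (measurable_pi_apply i).comp measurable_snd
  unfold mmdSqEst
  refine ((Measurable.div_const ?_ _).add (Measurable.div_const ?_ _)).sub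
    ((Measurable.const_mul ?_ _).div_const _)
  · exact Finset.measurable_fun_sum _ fun i _ => Finset.measurable_fun_sum _ fun j _ =>
      measurable_inner_comp hφ (h1 i) (h1 j)
  · exact Finset.measurable_fun_sum _ fun i _ => Finset.measurable_fun_sum _ fun j _ =>
      measurable_inner_comp hφ (h2 i) (h2 j)
  · exact Finset.measurable_fun_sum _ fun i _ => Finset.measurable_fun_sum _ fun j _ =>
      measurable_inner_comp hφ (h1 i) (h2 j)

/-- The estimator `mmdSqEst` is unbiased. -/
theorem integral_mmdSqEst [CompleteSpace H] {φ : E → H} (hφ : StronglyMeasurable φ) {b : ℝ}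
    (hb : ∀ x, inner ℝ (φ x) (φ x) ≤ b) (p q : Measure E) [IsProbabilityMeasure p]
    [IsProbabilityMeasure q] {n : ℕ} (hn : 2 ≤ n) :
    ∫ z, mmdSqEst (fun x y => inner ℝ (φ x) (φ y)) z.1 z.2
      ∂(Measure.pi fun _ : Fin n => p).prod (Measure.pi fun _ : Fin n => q) =
      mmdSqDist φ p q := by
  have hn' : (2 : ℝ) ≤ n := by exact_mod_cast hn
  set P := Measure.pi fun _ : Fin n => p
  set Q := Measure.pi fun _ : Fin n => q
  have h1 : ∀ i, Measurable fun z : (Fin n → E) × (Fin n → E) => z.1 i := fun i =>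
    (measurable_pi_apply i).comp measurable_fst
  have h2 : ∀ i, Measurable fun z : (Fin n → E) × (Fin n → E) => z.2 i := fun i =>
    (measurable_pi_apply i).comp measurable_snd
  have hintegrable : ∀ {u v : (Fin n → E) × (Fin n → E) → E}, Measurable u → Measurable v →
      Integrable (fun z => inner ℝ (φ (u z)) (φ (v z))) (P.prod Q) := fun hu hv =>
    integrable_of_abs_le (measurable_inner_comp hφ hu hv) fun z =>
      abs_inner_le_of_inner_self_le hb _ _
  have hmeas : StronglyMeasurable fun z : E × E => inner ℝ (φ z.1) (φ z.2) :=
    (hφ.comp_measurable measurable_fst).inner (hφ.comp_measurable measurable_snd)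
  have hpush : ∀ {r s : Measure E} [IsProbabilityMeasure r] [IsProbabilityMeasure s]
      {u : (Fin n → E) × (Fin n → E) → E × E}, MeasurePreserving u (P.prod Q) (r.prod s) →
      ∫ z, inner ℝ (φ (u z).1) (φ (u z).2) ∂P.prod Q =
        inner ℝ (∫ x, φ x ∂r) (∫ x, φ x ∂s) := by
    intro r s _ _ u hu
    rw [← integral_inner_prod hφ hb r s, ← hu.map_eq,
      integral_map hu.measurable.aemeasurable hmeas.aestronglyMeasurable]
  have eU : ∀ i j, i ≠ j → ∫ z : (Fin n → E) × (Fin n → E), inner ℝ (φ (z.1 i)) (φ (z.1 j))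
      ∂P.prod Q = inner ℝ (∫ x, φ x ∂p) (∫ x, φ x ∂p) := fun i j hij =>
    hpush ((measurePreserving_eval_prodMk (fun _ : Fin n => p) hij).comp measurePreserving_fst)
  have eV : ∀ i j, i ≠ j → ∫ z : (Fin n → E) × (Fin n → E), inner ℝ (φ (z.2 i)) (φ (z.2 j))
      ∂P.prod Q = inner ℝ (∫ x, φ x ∂q) (∫ x, φ x ∂q) := fun i j hij =>
    hpush ((measurePreserving_eval_prodMk (fun _ : Fin n => q) hij).comp measurePreserving_snd)
  have eW : ∀ i j, ∫ z : (Fin n → E) × (Fin n → E), inner ℝ (φ (z.1 i)) (φ (z.2 j))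
      ∂P.prod Q = inner ℝ (∫ x, φ x ∂p) (∫ x, φ x ∂q) := fun i j =>
    hpush ((measurePreserving_eval (fun _ : Fin n => p) i).prod
      (measurePreserving_eval (fun _ : Fin n => q) j))
  have iU : Integrable (fun z : (Fin n → E) × (Fin n → E) =>
      ∑ i, ∑ j ∈ Finset.univ.erase i, inner ℝ (φ (z.1 i)) (φ (z.1 j))) (P.prod Q) :=
    integrable_finsetSum _ fun i _ => integrable_finsetSum _ fun j _ => hintegrable (h1 i) (h1 j)
  have iV : Integrable (fun z : (Fin n → E) × (Fin n → E) =>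
      ∑ i, ∑ j ∈ Finset.univ.erase i, inner ℝ (φ (z.2 i)) (φ (z.2 j))) (P.prod Q) :=
    integrable_finsetSum _ fun i _ => integrable_finsetSum _ fun j _ => hintegrable (h2 i) (h2 j)
  have iW : Integrable (fun z : (Fin n → E) × (Fin n → E) =>
      ∑ i, ∑ j, inner ℝ (φ (z.1 i)) (φ (z.2 j))) (P.prod Q) :=
    integrable_finsetSum _ fun i _ => integrable_finsetSum _ fun j _ => hintegrable (h1 i) (h2 j)
  have iUV := (iU.div_const ((n : ℝ) * (n - 1))).fun_add (iV.div_const ((n : ℝ) * (n - 1)))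
  simp only [mmdSqEst]
  rw [integral_sub iUV ((iW.const_mul _).div_const _),
    integral_add (iU.div_const _) (iV.div_const _), integral_div, integral_div, integral_div,
    integral_const_mul,
    integral_finsetSum _ fun i _ => integrable_finsetSum _ fun j _ => hintegrable (h1 i) (h1 j),
    integral_finsetSum _ fun i _ => integrable_finsetSum _ fun j _ => hintegrable (h2 i) (h2 j),
    integral_finsetSum _ fun i _ => integrable_finsetSum _ fun j _ => hintegrable (h1 i) (h2 j)]
  have sU : ∀ i, ∫ z : (Fin n → E) × (Fin n → E),
      ∑ j ∈ Finset.univ.erase i, inner ℝ (φ (z.1 i)) (φ (z.1 j)) ∂P.prod Q =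
      (n - 1 : ℝ) * inner ℝ (∫ x, φ x ∂p) (∫ x, φ x ∂p) := fun i => by
    rw [integral_finsetSum _ fun j _ => hintegrable (h1 i) (h1 j),
      Finset.sum_congr rfl fun j hj => eU i j (Finset.ne_of_mem_erase hj).symm, Finset.sum_const,
      Finset.card_erase_of_mem (Finset.mem_univ i), Finset.card_univ, Fintype.card_fin,
      nsmul_eq_mul, Nat.cast_sub (one_le_two.trans hn), Nat.cast_one]
  have sV : ∀ i, ∫ z : (Fin n → E) × (Fin n → E),
      ∑ j ∈ Finset.univ.erase i, inner ℝ (φ (z.2 i)) (φ (z.2 j)) ∂P.prod Q =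
      (n - 1 : ℝ) * inner ℝ (∫ x, φ x ∂q) (∫ x, φ x ∂q) := fun i => by
    rw [integral_finsetSum _ fun j _ => hintegrable (h2 i) (h2 j),
      Finset.sum_congr rfl fun j hj => eV i j (Finset.ne_of_mem_erase hj).symm, Finset.sum_const,
      Finset.card_erase_of_mem (Finset.mem_univ i), Finset.card_univ, Fintype.card_fin,
      nsmul_eq_mul, Nat.cast_sub (one_le_two.trans hn), Nat.cast_one]
  have sW : ∀ i, ∫ z : (Fin n → E) × (Fin n → E),
      ∑ j, inner ℝ (φ (z.1 i)) (φ (z.2 j)) ∂P.prod Q =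
      n * inner ℝ (∫ x, φ x ∂p) (∫ x, φ x ∂q) := fun i => by
    rw [integral_finsetSum _ fun j _ => hintegrable (h1 i) (h2 j),
      Finset.sum_congr rfl fun j _ => eW i j, Finset.sum_const, Finset.card_univ,
      Fintype.card_fin, nsmul_eq_mul]
  simp only [sU, sV, sW, Finset.sum_const, Finset.card_univ, Fintype.card_fin, nsmul_eq_mul]
  rw [mmdSqDist, norm_sub_sq_real, real_inner_self_eq_norm_sq, real_inner_self_eq_norm_sq]
  have hn1 : (n : ℝ) - 1 ≠ 0 := by linarith
  field_simp
  ring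

end MMDConcentration

section MMDConcentrationGeneral

open scoped NNReal
open ProbabilityTheory

theorem exists_stronglyMeasurable_mem_range {E β : Type*} [MeasurableSpace E] [TopologicalSpace β]
    [Nonempty E] {φ : E → β} {ρ : Measure E} (hφ : AEStronglyMeasurable φ ρ) :
    ∃ ψ : E → β, StronglyMeasurable ψ ∧ φ =ᵐ[ρ] ψ ∧ ∀ x, ψ x ∈ Set.range φ := by
  obtain ⟨x₀⟩ := ‹Nonempty E›
  obtain ⟨N, hN, hNm, hN0⟩ := exists_measurable_superset_of_null hφ.ae_eq_mk
  have hmk : ∀ x ∉ N, φ x = hφ.mk φ x := fun x hx => by_contra fun hne => hx (hN hne)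
  refine ⟨N.piecewise (fun _ => φ x₀) (hφ.mk φ),
    stronglyMeasurable_const.piecewise hNm hφ.stronglyMeasurable_mk, ?_, fun x => ?_⟩
  · filter_upwards [measure_eq_zero_iff_ae_notMem.1 hN0] with x hx
    rw [Set.piecewise_eq_of_notMem _ _ _ hx, hmk x hx]
  · by_cases hx : x ∈ N
    · exact ⟨x₀, by rw [Set.piecewise_eq_of_mem _ _ _ hx]⟩
    · exact ⟨x, by rw [Set.piecewise_eq_of_notMem _ _ _ hx, hmk x hx]⟩

variable {E : Type*} [MeasurableSpace E] {H : Type*} [NormedAddCommGroup H]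
  [InnerProductSpace ℝ H] [CompleteSpace H]

theorem hasSubgaussianMGF_mmdSqEst_of_stronglyMeasurable {φ : E → H} (hφ : StronglyMeasurable φ)
    {b : ℝ≥0} (hg : ∀ x y, 0 ≤ inner ℝ (φ x) (φ y) ∧ inner ℝ (φ x) (φ y) ≤ b)
    (p q : Measure E) [IsProbabilityMeasure p] [IsProbabilityMeasure q] {n : ℕ} (hn : 2 ≤ n) :
    HasSubgaussianMGF (fun z => mmdSqEst (fun x y => inner ℝ (φ x) (φ y)) z.1 z.2 -
      mmdSqDist φ p q) (2 * n * (4 * b / n) ^ 2)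
      ((Measure.pi fun _ : Fin n => p).prod (Measure.pi fun _ : Fin n => q)) := by
  have hbdd := boundedDiff_mmdSqEst hg hn
  rw [← integral_mmdSqEst hφ (fun x => (hg x x).2) p q hn]
  refine hasSubgaussianMGF_of_boundedDiff_prod (c := 4 * b / n) (measurable_mmdSqEst hφ n)
    (fun z => abs_mmdSqEst_le hg hn z.1 z.2) (fun y => ?_) fun x => ?_
  · simpa using hbdd y
  · simpa [mmdSqEst_comm (fun a b => real_inner_comm (φ b) (φ a)) x] using hbdd x

theorem hasSubgaussianMGF_mmdSqEst {φ : E → H} {b : ℝ≥0}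
    (hg : ∀ x y, 0 ≤ inner ℝ (φ x) (φ y) ∧ inner ℝ (φ x) (φ y) ≤ b)
    (p q : Measure E) [IsProbabilityMeasure p] [IsProbabilityMeasure q]
    (hp : AEStronglyMeasurable φ p) (hq : AEStronglyMeasurable φ q) {n : ℕ} (hn : 2 ≤ n) :
    HasSubgaussianMGF (fun z => mmdSqEst (fun x y => inner ℝ (φ x) (φ y)) z.1 z.2 -
      mmdSqDist φ p q) (2 * n * (4 * b / n) ^ 2)
      ((Measure.pi fun _ : Fin n => p).prod (Measure.pi fun _ : Fin n => q)) := by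
  have : Nonempty E := nonempty_of_isProbabilityMeasure p
  obtain ⟨ψ, hψ, hae, hrange⟩ := exists_stronglyMeasurable_mem_range (hp.add_measure hq)
  rw [Filter.EventuallyEq, ae_add_measure_iff] at hae
  have hg' : ∀ x y, 0 ≤ inner ℝ (ψ x) (ψ y) ∧ inner ℝ (ψ x) (ψ y) ≤ b := fun x y => by
    obtain ⟨x', hx'⟩ := hrange x
    obtain ⟨y', hy'⟩ := hrange y
    rw [← hx', ← hy']
    exact hg x' y'
  have hdist : mmdSqDist ψ p q = mmdSqDist φ p q := by
    rw [mmdSqDist, mmdSqDist, integral_congr_ae hae.1, integral_congr_ae hae.2]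
  refine (hasSubgaussianMGF_mmdSqEst_of_stronglyMeasurable hψ hg' p q hn).congr ?_
  have h1 : ∀ᵐ z : (Fin n → E) × (Fin n → E)
      ∂(Measure.pi fun _ : Fin n => p).prod (Measure.pi fun _ : Fin n => q),
      ∀ i, φ (z.1 i) = ψ (z.1 i) := ae_all_iff.2 fun i =>
    ((measurePreserving_eval (fun _ : Fin n => p) i).comp
      measurePreserving_fst).quasiMeasurePreserving.ae hae.1
  have h2 : ∀ᵐ z : (Fin n → E) × (Fin n → E)
      ∂(Measure.pi fun _ : Fin n => p).prod (Measure.pi fun _ : Fin n => q),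
      ∀ i, φ (z.2 i) = ψ (z.2 i) := ae_all_iff.2 fun i =>
    ((measurePreserving_eval (fun _ : Fin n => q) i).comp
      measurePreserving_snd).quasiMeasurePreserving.ae hae.2
  filter_upwards [h1, h2] with z hz1 hz2
  simp only [mmdSqEst, hz1, hz2, hdist]

theorem measureReal_mmdSqEst_sub_ge_le {φ : E → H} {b : ℝ≥0}
    (hg : ∀ x y, 0 ≤ inner ℝ (φ x) (φ y) ∧ inner ℝ (φ x) (φ y) ≤ b)
    (p q : Measure E) [IsProbabilityMeasure p] [IsProbabilityMeasure q]
    (hp : AEStronglyMeasurable φ p) (hq : AEStronglyMeasurable φ q) {n : ℕ} (hn : 2 ≤ n)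
    {t : ℝ} (ht : 0 ≤ t) :
    ((Measure.pi fun _ : Fin n => p).prod (Measure.pi fun _ : Fin n => q)).real
      {z | t ≤ mmdSqEst (fun x y => inner ℝ (φ x) (φ y)) z.1 z.2 - mmdSqDist φ p q} ≤
        Real.exp (-(n * t ^ 2 / (64 * (b : ℝ) ^ 2))) ∧
    ((Measure.pi fun _ : Fin n => p).prod (Measure.pi fun _ : Fin n => q)).real
      {z | t ≤ -(mmdSqEst (fun x y => inner ℝ (φ x) (φ y)) z.1 z.2 - mmdSqDist φ p q)} ≤
        Real.exp (-(n * t ^ 2 / (64 * (b : ℝ) ^ 2))) := by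
  have h := hasSubgaussianMGF_mmdSqEst hg p q hp hq hn
  have hn' : (0 : ℝ) < n := by exact_mod_cast zero_lt_two.trans_le hn
  have he : -t ^ 2 / (2 * ((2 * n * (4 * b / n) ^ 2 : ℝ≥0) : ℝ)) =
      -(n * t ^ 2 / (64 * (b : ℝ) ^ 2)) := by
    push_cast
    field_simp
    ring
  rw [← he]
  exact ⟨h.measure_ge_le ht, h.neg.measure_ge_le ht⟩

end MMDConcentrationGeneral

section MMDClustering

open scoped NNReal ENNReal

variable {E : Type*} [MeasurableSpace E] {H : Type*} [NormedAddCommGroup H]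
  [InnerProductSpace ℝ H]

theorem mmdSqDist_le {φ : E → H} {b : ℝ} (hb : ∀ x, inner ℝ (φ x) (φ x) ≤ b) (p q : Measure E)
    [IsProbabilityMeasure p] [IsProbabilityMeasure q] : mmdSqDist φ p q ≤ 4 * b := by
  have hφ : ∀ x, ‖φ x‖ ≤ √b := fun x =>
    Real.le_sqrt_of_sq_le (by rw [← real_inner_self_eq_norm_sq]; exact hb x)
  have hintegrable : ∀ r : Measure E, IsProbabilityMeasure r → ‖∫ x, φ x ∂r‖ ≤ √b := fun r _ => by
    simpa using norm_integral_le_of_norm_le_const (μ := r) (.of_forall hφ)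
  obtain ⟨x⟩ := nonempty_of_isProbabilityMeasure p
  have hb0 : 0 ≤ b := real_inner_self_nonneg.trans (hb x)
  calc mmdSqDist φ p q ≤ (2 * √b) ^ 2 := by
        refine pow_le_pow_left₀ (norm_nonneg _) ?_ 2
        linarith [norm_sub_le (∫ x, φ x ∂p) (∫ x, φ x ∂q), hintegrable p ‹_›, hintegrable q ‹_›]
    _ = 4 * b := by rw [mul_pow, Real.sq_sqrt hb0]; norm_num

theorem measure_not_correctClustering_alg4_mmd_le {ι κ : Type*} [Fintype ι] [DecidableEq ι]
    (gen : ι → κ) {φ : E → H} {b : ℝ}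
    (hg : ∀ x y, 0 ≤ inner ℝ (φ x) (φ y) ∧ inner ℝ (φ x) (φ y) ≤ b)
    (P : κ → Set (Measure E)) (hP : ∀ k, ∀ p ∈ P k, IsProbabilityMeasure p)
    (hφ : ∀ k, ∀ p ∈ P k, Integrable φ p) {dL dH : ℝ}
    (hdL : sSup {r : ℝ | ∃ k, ∃ p ∈ P k, ∃ q ∈ P k, r = mmdSqDist φ p q} = dL)
    (hdH : sInf {r : ℝ | ∃ k k', k ≠ k' ∧ ∃ p ∈ P k, ∃ q ∈ P k', r = mmdSqDist φ p q} = dH)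
    (h : dL < dH) {n : ℕ} (q : ι → Measure E) (hq : ∀ i, q i ∈ P (gen i)) (i₀ : ι) (T : ℕ) :
    (Measure.pi fun i => Measure.pi fun _ : Fin n => q i)
      {ω | ¬ CorrectClustering gen (alg4 ω
        (fun x y => mmdSqEst (fun x y => inner ℝ (φ x) (φ y)) x y) ((dH + dL) / 2) i₀ T)} ≤
    ENNReal.ofReal ((Fintype.card ι : ℝ) ^ 2 * (2 * (T : ℝ) + 3) *
      Real.exp (-((n : ℝ) * (dH - dL) ^ 2 / (256 * b ^ 2)))) := by
  have hprob : ∀ i, IsProbabilityMeasure (q i) := fun i => hP _ _ (hq i)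
  have hM : (1 : ℝ) ≤ Fintype.card ι := by exact_mod_cast Fintype.card_pos_iff.2 ⟨i₀⟩
  have hT : (0 : ℝ) ≤ T := Nat.cast_nonneg T
  have hnonneg : ∀ p q : Measure E, 0 ≤ mmdSqDist φ p q := fun p q => sq_nonneg _
  have hdL0 : 0 ≤ dL := by
    rw [← hdL]
    refine Real.sSup_nonneg ?_
    rintro r ⟨k, p, -, p', -, rfl⟩
    exact hnonneg p p'
  have hcomplete : CompleteSpace H := by
    by_contra hc
    have : dH ≤ 0 := by
      rw [← hdH]
      refine Real.sInf_nonpos ?_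
      rintro r ⟨k, k', -, p, -, p', -, rfl⟩
      simp [mmdSqDist, integral, hc]
    linarith
  have hwithin : ∀ i j, gen i = gen j → mmdSqDist φ (q i) (q j) ≤ dL := by
    intro i j hij
    rw [← hdL]
    refine le_csSup ⟨4 * b, ?_⟩ ⟨gen i, q i, hq i, q j, hij ▸ hq j, rfl⟩
    rintro r ⟨k, p, hp, p', hp', rfl⟩
    have := hP _ _ hp
    have := hP _ _ hp'
    exact mmdSqDist_le (fun x => (hg x x).2) p p'
  have hbelow : BddBelow {r : ℝ | ∃ k k', k ≠ k' ∧ ∃ p ∈ P k, ∃ q ∈ P k',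
      r = mmdSqDist φ p q} := by
    refine ⟨0, ?_⟩
    rintro r ⟨k, k', -, p, -, p', -, rfl⟩
    exact hnonneg p p'
  have hacross : ∀ i j, gen i ≠ gen j → dH ≤ mmdSqDist φ (q i) (q j) := by
    intro i j hij
    rw [← hdH]
    exact csInf_le hbelow ⟨gen i, gen j, hij, q i, hq i, q j, hq j, rfl⟩
  have hdHb : dH ≤ 4 * b := by
    rcases Set.eq_empty_or_nonempty {r : ℝ | ∃ k k', k ≠ k' ∧ ∃ p ∈ P k, ∃ q ∈ P k',
      r = mmdSqDist φ p q} with he | ⟨r, hr⟩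
    · rw [he, Real.sInf_empty] at hdH
      linarith
    · rw [← hdH]
      refine (csInf_le hbelow hr).trans ?_
      obtain ⟨k, k', -, p, hp, p', hp', rfl⟩ := hr
      have := hP _ _ hp
      have := hP _ _ hp'
      exact mmdSqDist_le (fun x => (hg x x).2) p p'
  have hb : 0 < b := by linarith
  lift b to ℝ≥0 using hb.le
  rcases Nat.lt_or_ge n 2 with hn | hn
  · refine prob_le_one.trans (ENNReal.one_le_ofReal.2 ?_)
    have hn1 : (n : ℝ) ≤ 1 := by exact_mod_cast Nat.lt_succ_iff.1 hn
    have h1 : (n : ℝ) * (dH - dL) ^ 2 / (256 * b ^ 2) ≤ 1 / 16 := by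
      rw [div_le_iff₀ (by positivity)]
      have h2 : (dH - dL) ^ 2 ≤ (4 * b) ^ 2 := pow_le_pow_left₀ (by linarith) (by linarith) 2
      calc (n : ℝ) * (dH - dL) ^ 2 ≤ 1 * (4 * b) ^ 2 := by gcongr
        _ = _ := by ring
    have h2 : 15 / 16 ≤ Real.exp (-((n : ℝ) * (dH - dL) ^ 2 / (256 * b ^ 2))) := by
      linarith [Real.add_one_le_exp (-((n : ℝ) * (dH - dL) ^ 2 / (256 * b ^ 2)))]
    calc (1 : ℝ) ≤ 1 ^ 2 * (2 * 0 + 3) * (15 / 16) := by norm_num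
      _ ≤ _ := by gcongr
  set est : (Fin n → E) → (Fin n → E) → ℝ := fun x y =>
    mmdSqEst (fun x y => inner ℝ (φ x) (φ y)) x y with hest
  let X : ι → ι → Set ((Fin n → E) × (Fin n → E)) := fun i j =>
    if gen i = gen j then
      {z | (dH - dL) / 2 ≤ est z.1 z.2 - mmdSqDist φ (q i) (q j)}
    else {z | (dH - dL) / 2 ≤ -(est z.1 z.2 - mmdSqDist φ (q i) (q j))}
  have hsub : {ω | ¬ CorrectClustering gen (alg4 ω est ((dH + dL) / 2) i₀ T)} ⊆
      ⋃ pr : {pr : ι × ι // pr.1 ≠ pr.2},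
        (fun ω : ι → Fin n → E => (ω pr.1.1, ω pr.1.2)) ⁻¹' X pr.1.1 pr.1.2 := by
    intro ω hω
    by_contra hgood
    simp only [Set.mem_iUnion, Set.mem_preimage, not_exists, Subtype.forall, Prod.forall]
      at hgood
    refine hω (correctClustering_alg4 (fun i j => ?_) i₀ T)
    rcases eq_or_ne i j with rfl | hij
    · refine iff_of_true ?_ rfl
      have hself := mmdSqEst_self_nonpos (g := fun x y => inner ℝ (φ x) (φ y)) (fun x y => ?_)
        hn (ω i)
      · exact hself.trans (by linarith)
      · have := real_inner_self_nonneg (x := φ x - φ y)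
        rw [real_inner_sub_sub_self] at this
        linarith
    · have hX := hgood i j hij
      by_cases hgen : gen i = gen j
      · rw [show X i j = _ from if_pos hgen, Set.mem_ofPred_eq, not_le] at hX
        exact iff_of_true (by linarith [hwithin i j hgen]) hgen
      · rw [show X i j = _ from if_neg hgen, Set.mem_ofPred_eq, not_le] at hX
        exact iff_of_false (by linarith [hacross i j hgen]) hgen
  have hX : ∀ i j, ((Measure.pi fun _ : Fin n => q i).prod (Measure.pi fun _ : Fin n => q j))
      (X i j) ≤ ENNReal.ofReal (Real.exp (-((n : ℝ) * (dH - dL) ^ 2 / (256 * b ^ 2)))) := by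
    intro i j
    have htail := measureReal_mmdSqEst_sub_ge_le hg (q i) (q j)
      (hφ _ _ (hq i)).1 (hφ _ _ (hq j)).1 hn (t := (dH - dL) / 2) (by linarith)
    have he : (n : ℝ) * ((dH - dL) / 2) ^ 2 / (64 * (b : ℝ) ^ 2) =
        n * (dH - dL) ^ 2 / (256 * b ^ 2) := by
      field_simp
      ring
    rw [he] at htail
    rw [← ofReal_measureReal]
    refine ENNReal.ofReal_le_ofReal ?_
    by_cases hgen : gen i = gen j
    · rw [show X i j = _ from if_pos hgen]
      exact htail.1
    · rw [show X i j = _ from if_neg hgen]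
      exact htail.2
  calc _ ≤ ∑ pr : {pr : ι × ι // pr.1 ≠ pr.2},
        (Measure.pi fun i => Measure.pi fun _ : Fin n => q i)
          ((fun ω : ι → Fin n → E => (ω pr.1.1, ω pr.1.2)) ⁻¹' X pr.1.1 pr.1.2) :=
        (measure_mono hsub).trans (measure_iUnion_fintype_le _ _)
    _ ≤ ∑ _pr : {pr : ι × ι // pr.1 ≠ pr.2},
        ENNReal.ofReal (Real.exp (-((n : ℝ) * (dH - dL) ^ 2 / (256 * b ^ 2)))) := by
        refine Finset.sum_le_sum fun pr _ => ?_
        have hmp := measurePreserving_eval_prodMk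
          (fun i => Measure.pi fun _ : Fin n => q i) pr.2
        refine (Measure.le_map_apply hmp.measurable.aemeasurable _).trans ?_
        rw [hmp.map_eq]
        exact hX _ _
    _ = ENNReal.ofReal (Fintype.card {pr : ι × ι // pr.1 ≠ pr.2} *
          Real.exp (-((n : ℝ) * (dH - dL) ^ 2 / (256 * b ^ 2)))) := by
        rw [Finset.sum_const, Finset.card_univ, nsmul_eq_mul,
          ENNReal.ofReal_mul (Nat.cast_nonneg _), ENNReal.ofReal_natCast]
    _ ≤ _ := by
        refine ENNReal.ofReal_le_ofReal (mul_le_mul_of_nonneg_right ?_ (Real.exp_pos _).le)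
        have hcard : (Fintype.card {pr : ι × ι // pr.1 ≠ pr.2} : ℝ) ≤
            (Fintype.card ι : ℝ) ^ 2 := by
          rw [sq]
          exact_mod_cast (Fintype.card_subtype_le _).trans_eq (Fintype.card_prod ι ι)
        nlinarith [sq_nonneg (Fintype.card ι : ℝ)]

end MMDClustering

/-- Corollary 2: error probability of the merge-based Algorithm 4 under
KS and MMD. If the KS distance with threshold `d_th = (d_{H,ks}+d_{L,ks})/2` is used in
Algorithm 4, the error probability after `T` iterations satisfies
`P_e^{KS} ≤ M² (10T+14) exp(−n Δ_ks²/8)`; if MMD² with a kernel bounded by `𝕂` and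
threshold `d_th = (d_{H,mmd}+d_{L,mmd})/2` is used, then
`P_e^{MMD} ≤ M² (2T+3) exp(−n Δ_mmd²/(256 𝕂²))`, where `Δ = d_H − d_L` in each case and
`d_L < d_H` is assumed. -/
theorem stmt14
    -- setup for the KS-distance instance
    {K : ℕ} (Pks : Fin K → Set (Measure ℝ))
    (hPks : ∀ k, ∀ p ∈ Pks k, IsProbabilityMeasure p)
    (dLks dHks : ℝ)
    (hdLks : sSup {r : ℝ | ∃ k : Fin K, ∃ p ∈ Pks k, ∃ q ∈ Pks k, r = ksDist p q} = dLks)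
    (hdHks : sInf {r : ℝ |
        ∃ k k' : Fin K, k ≠ k' ∧ ∃ p ∈ Pks k, ∃ q ∈ Pks k', r = ksDist p q} = dHks)
    (hks : dLks < dHks)
    {n : ℕ} (Mk : Fin K → ℕ)
    (qks : ∀ k : Fin K, Fin (Mk k) → Measure ℝ)
    (hqks : ∀ k j, qks k j ∈ Pks k)
    (hprobks : ∀ k j, IsProbabilityMeasure (qks k j))
    (μks : Measure (∀ _ : (Σ k : Fin K, Fin (Mk k)), Fin n → ℝ))
    (hμks : μks = Measure.pi fun i : (Σ k : Fin K, Fin (Mk k)) =>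
        Measure.pi fun _ : Fin n => qks i.1 i.2)
    (Mr : ℝ) (hMr : Mr = ∑ k, (Mk k : ℝ))
    (i₀ : Σ k : Fin K, Fin (Mk k)) (T : ℕ)
    -- setup for the MMD instance
    {m K' : ℕ} {H : Type*} [NormedAddCommGroup H] [InnerProductSpace ℝ H]
    (g : (Fin m → ℝ) → (Fin m → ℝ) → ℝ) (φ : (Fin m → ℝ) → H)
    (hgφ : ∀ x y, g x y = @inner ℝ H _ (φ x) (φ y))
    (𝕂 : ℝ) (hg : ∀ x y, 0 ≤ g x y ∧ g x y ≤ 𝕂)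
    (Pm : Fin K' → Set (Measure (Fin m → ℝ)))
    (hPm : ∀ k, ∀ p ∈ Pm k, IsProbabilityMeasure p)
    (hPmint : ∀ k, ∀ p ∈ Pm k, Integrable φ p)
    (dLm dHm : ℝ)
    (hdLm : sSup {r : ℝ | ∃ k : Fin K', ∃ p ∈ Pm k, ∃ q ∈ Pm k, r = mmdSqDist φ p q} = dLm)
    (hdHm : sInf {r : ℝ |
        ∃ k k' : Fin K', k ≠ k' ∧ ∃ p ∈ Pm k, ∃ q ∈ Pm k', r = mmdSqDist φ p q} = dHm)
    (hm : dLm < dHm)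
    (Mk' : Fin K' → ℕ)
    (qm : ∀ k : Fin K', Fin (Mk' k) → Measure (Fin m → ℝ))
    (hqm : ∀ k j, qm k j ∈ Pm k)
    (hprobm : ∀ k j, IsProbabilityMeasure (qm k j))
    (μm : Measure (∀ _ : (Σ k : Fin K', Fin (Mk' k)), Fin n → (Fin m → ℝ)))
    (hμm : μm = Measure.pi fun i : (Σ k : Fin K', Fin (Mk' k)) =>
        Measure.pi fun _ : Fin n => qm i.1 i.2)
    (Mr' : ℝ) (hMr' : Mr' = ∑ k, (Mk' k : ℝ))
    (i₀' : Σ k : Fin K', Fin (Mk' k)) :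
    μks {ω | ¬ CorrectClustering (fun i => i.1)
          (alg4 ω (fun x y => ksDistSeq x y) ((dHks + dLks) / 2) i₀ T)}
      ≤ ENNReal.ofReal (Mr ^ 2 * (10 * (T : ℝ) + 14) *
          Real.exp (-((n : ℝ) * (dHks - dLks) ^ 2 / 8))) ∧
    μm {ω | ¬ CorrectClustering (fun i => i.1)
          (alg4 ω (fun x y => mmdSqEst g x y) ((dHm + dLm) / 2) i₀' T)}
      ≤ ENNReal.ofReal (Mr' ^ 2 * (2 * (T : ℝ) + 3) *
          Real.exp (-((n : ℝ) * (dHm - dLm) ^ 2 / (256 * 𝕂 ^ 2)))) := by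
  subst hμks hμm hMr hMr'
  obtain rfl : g = fun x y => inner ℝ (φ x) (φ y) := by
    funext x y
    exact hgφ x y
  have hcard : ∀ {L : ℕ} (N : Fin L → ℕ),
      (Fintype.card (Σ k : Fin L, Fin (N k)) : ℝ) = ∑ k, (N k : ℝ) := fun N => by
    simp [Fintype.card_sigma]
  rw [← hcard Mk, ← hcard Mk']
  exact ⟨measure_not_correctClustering_alg4_ks_le (fun i : Σ k : Fin K, Fin (Mk k) => i.1) Pks
      hPks hdLks hdHks hks (fun i => qks i.1 i.2) (fun i => hqks i.1 i.2) i₀ T,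
    measure_not_correctClustering_alg4_mmd_le (fun i : Σ k : Fin K', Fin (Mk' k) => i.1) hg Pm
      hPm hPmint hdLm hdHm hm (fun i => qm i.1 i.2) (fun i => hqm i.1 i.2) i₀' T⟩
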